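/- arXiv:1008.0023 — 6 statements merged into one kernel-verified Lean document; each statement's English description precedes it below -/
import Mathlib

section
/- Let R be a supertropical domain and let A ∈ M_n(R) be multiplicatively idempotent (A·A = A) and nonsingular (its supertropical determinant |A| is tangible). Then A is a quasi-identity matrix: every diagonal entry A(i,i) equals 1, and every off-diagonal entry A(i,j) (i ≠ j) lies in the ghost ideal G₀. -/
/-- A supertropical semiring structure on a commutative semiring `R`, given by the ghost
map `ν`.  The ghost ideal is `Set.range ν`; the tangible elements are those not in it. -/
structure IsSupertropical {R : Type*} [CommSemiring R] (ν : R → R) : Prop where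
  idem : ∀ a : R, ν (ν a) = ν a
  addMap : ∀ a b : R, ν (a + b) = ν a + ν b
  mulMap : ∀ a b : R, ν (a * b) = ν a * ν b
  ghost : ∀ a : R, ν a = a + a
  addEq : ∀ a b : R, ν a = ν b → a + b = ν a
  addNe : ∀ a b : R, ν a ≠ ν b → a + b = a ∨ a + b = b

/-- A supertropical domain: a supertropical semiring in which the tangible elements
`T = R \ ν(R)` form a cancellative multiplicative monoid and `ν` maps `T` onto `ν(R) \ {0}`. -/
structure IsSupertropicalDomain {R : Type*} [CommSemiring R] (ν : R → R)
    extends IsSupertropical ν : Prop where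
  oneTangible : (1 : R) ∉ Set.range ν
  mulTangible : ∀ a b : R, a ∉ Set.range ν → b ∉ Set.range ν → a * b ∉ Set.range ν
  cancelTangible : ∀ a b c : R, a ∉ Set.range ν → b ∉ Set.range ν → c ∉ Set.range ν →
    a * b = a * c → b = c
  onto : ∀ g ∈ Set.range ν, g ≠ 0 → ∃ t ∉ Set.range ν, ν t = g

/-- The supertropical determinant (permanent) of a square matrix. -/
noncomputable def stPer {m : Type*} [Fintype m] [DecidableEq m] {R : Type*} [CommSemiring R]
    (A : Matrix m m R) : R :=
  ∑ σ : Equiv.Perm m, ∏ i, A i (σ i)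


/-- The preorder on `R` comparing ghost values: `a` is dominated by `b`. -/
def NuLE {R : Type*} [CommSemiring R] (ν : R → R) (a b : R) : Prop := ν a + ν b = ν b

namespace IsSupertropical

variable {R : Type*} [CommSemiring R] {ν : R → R}

theorem nu_zero (h : IsSupertropical ν) : ν 0 = 0 := by
  rw [h.ghost, add_zero]

theorem eq_zero_of_nu_eq_zero (h : IsSupertropical ν) {a : R} (ha : ν a = 0) : a = 0 := by
  have := h.addEq a 0 (ha.trans h.nu_zero.symm)
  rwa [add_zero, ha] at this

theorem ghost_mul_mem_range (h : IsSupertropical ν) {a : R} (b : R) (ha : a ∈ Set.range ν) :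
    a * b ∈ Set.range ν := by
  obtain ⟨c, rfl⟩ := ha
  exact ⟨c * b, by rw [h.ghost, h.ghost, add_mul]⟩

theorem nuLE_refl (h : IsSupertropical ν) (a : R) : NuLE ν a a := by
  rw [NuLE, ← h.ghost, h.idem]

theorem nuLE_trans {a b c : R} (hab : NuLE ν a b) (hbc : NuLE ν b c) : NuLE ν a c := by
  unfold NuLE at *
  rw [← hbc, ← add_assoc, hab]

theorem nu_eq_of_nuLE {a b : R} (hab : NuLE ν a b) (hba : NuLE ν b a) : ν a = ν b := by
  unfold NuLE at *
  rw [← hab, add_comm, hba]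

theorem nuLE_of_nu_eq (h : IsSupertropical ν) {a b : R} (hab : ν a = ν b) : NuLE ν a b := by
  have := h.nuLE_refl b
  rwa [NuLE, ← hab] at *

theorem nuLE_total (h : IsSupertropical ν) (a b : R) : NuLE ν a b ∨ NuLE ν b a := by
  by_cases hab : ν a = ν b
  · exact .inl (h.nuLE_of_nu_eq hab)
  · rcases h.addNe a b hab with e | e
    · right; rw [NuLE, add_comm, ← h.addMap, e]
    · left; rw [NuLE, ← h.addMap, e]

theorem zero_nuLE (h : IsSupertropical ν) (a : R) : NuLE ν 0 a := by
  rw [NuLE, h.nu_zero, zero_add]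

theorem eq_zero_of_nuLE_zero (h : IsSupertropical ν) {a : R} (ha : NuLE ν a 0) : a = 0 := by
  rw [NuLE, h.nu_zero, add_zero] at ha
  exact h.eq_zero_of_nu_eq_zero ha

theorem nuLE_mul (h : IsSupertropical ν) {a b c d : R} (hab : NuLE ν a b) (hcd : NuLE ν c d) :
    NuLE ν (a * c) (b * d) := by
  apply nuLE_trans (b := b * c)
  · unfold NuLE at *
    rw [h.mulMap, h.mulMap, ← add_mul, hab]
  · unfold NuLE at *
    rw [h.mulMap, h.mulMap, ← mul_add, hcd]

theorem nuLE_prod (h : IsSupertropical ν) {ι : Type*} (s : Finset ι) {f g : ι → R}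
    (hfg : ∀ i ∈ s, NuLE ν (f i) (g i)) : NuLE ν (∏ i ∈ s, f i) (∏ i ∈ s, g i) := by
  classical
  induction s using Finset.induction_on with
  | empty => exact h.nuLE_refl _
  | insert a s ha ih =>
    rw [Finset.prod_insert ha, Finset.prod_insert ha]
    exact h.nuLE_mul (hfg a (Finset.mem_insert_self a s))
      (ih fun i hi => hfg i (Finset.mem_insert_of_mem hi))

theorem nuLE_add_left (h : IsSupertropical ν) (a b : R) : NuLE ν a (a + b) := by
  rw [NuLE, h.addMap, ← add_assoc, h.nuLE_refl a]

theorem nuLE_sum_of_mem (h : IsSupertropical ν) {ι : Type*} {s : Finset ι} (f : ι → R) {i : ι}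
    (hi : i ∈ s) : NuLE ν (f i) (∑ j ∈ s, f j) := by
  classical
  rw [← Finset.add_sum_erase s f hi]
  exact h.nuLE_add_left _ _

theorem add_eq_right_of_not_nuLE (h : IsSupertropical ν) {a b : R} (hba : ¬ NuLE ν b a) :
    a + b = b := by
  refine (h.addNe a b fun e => hba (h.nuLE_of_nu_eq e.symm)).resolve_left fun e => hba ?_
  rw [NuLE, add_comm, ← h.addMap, e]

theorem exists_nuLE_of_nuLE_sum (h : IsSupertropical ν) {ι : Type*} {s : Finset ι} {f : ι → R}
    {c : R} (hc : c ≠ 0) (hs : NuLE ν c (∑ i ∈ s, f i)) : ∃ i ∈ s, NuLE ν c (f i) := by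
  classical
  induction s using Finset.induction_on with
  | empty => exact absurd (h.eq_zero_of_nuLE_zero hs) hc
  | insert a s ha ih =>
    rw [Finset.sum_insert ha] at hs
    by_cases hle : NuLE ν (∑ i ∈ s, f i) (f a)
    · refine ⟨a, Finset.mem_insert_self a s, nuLE_trans hs ?_⟩
      unfold NuLE at *
      rw [h.addMap, add_assoc, hle, h.nuLE_refl]
    · rw [h.add_eq_right_of_not_nuLE hle] at hs
      obtain ⟨i, hi, hci⟩ := ih hs
      exact ⟨i, Finset.mem_insert_of_mem hi, hci⟩

/-- A tangible sum equals one of its terms, which strictly dominates all the others. -/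
theorem exists_dominant_of_sum_tangible (h : IsSupertropical ν) {ι : Type*} {s : Finset ι}
    {f : ι → R} (hs : ∑ i ∈ s, f i ∉ Set.range ν) :
    ∃ i ∈ s, ∑ j ∈ s, f j = f i ∧ ∀ j ∈ s, j ≠ i → ¬ NuLE ν (f i) (f j) := by
  classical
  induction s using Finset.induction_on with
  | empty => exact absurd ⟨0, h.nu_zero⟩ hs
  | insert a s ha ih =>
    rw [Finset.sum_insert ha] at hs ⊢
    have hne : ν (f a) ≠ ν (∑ i ∈ s, f i) := fun e => hs ⟨_, (h.addEq _ _ e).symm⟩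
    by_cases hle : NuLE ν (∑ i ∈ s, f i) (f a)
    · have hlt : ¬ NuLE ν (f a) (∑ i ∈ s, f i) := fun hle' => hne (nu_eq_of_nuLE hle' hle)
      refine ⟨a, Finset.mem_insert_self a s, ?_, fun j hj hja hle' => hlt ?_⟩
      · rw [add_comm, h.add_eq_right_of_not_nuLE hlt]
      · exact nuLE_trans hle'
          (h.nuLE_sum_of_mem f (Finset.mem_of_mem_insert_of_ne hj hja))
    · rw [h.add_eq_right_of_not_nuLE hle] at hs ⊢
      obtain ⟨i, hi, he, hlt⟩ := ih hs
      refine ⟨i, Finset.mem_insert_of_mem hi, he, fun j hj hji => ?_⟩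
      rcases Finset.mem_insert.mp hj with rfl | hj
      · rwa [← he]
      · exact hlt j hj hji

end IsSupertropical

namespace IsSupertropicalDomain

open IsSupertropical

variable {R : Type*} [CommSemiring R] {ν : R → R}

theorem exists_tangible_nu_eq (h : IsSupertropicalDomain ν) {a : R} (ha : a ≠ 0) :
    ∃ t ∉ Set.range ν, ν t = ν a :=
  h.onto (ν a) ⟨a, rfl⟩ fun e => ha (h.eq_zero_of_nu_eq_zero e)

theorem tangible_ne_zero (h : IsSupertropicalDomain ν) {a : R} (ha : a ∉ Set.range ν) : a ≠ 0 := by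
  rintro rfl
  exact ha ⟨0, h.nu_zero⟩

theorem mul_ne_zero (h : IsSupertropicalDomain ν) {a b : R} (ha : a ≠ 0) (hb : b ≠ 0) :
    a * b ≠ 0 := by
  obtain ⟨s, hs, hsa⟩ := h.exists_tangible_nu_eq ha
  obtain ⟨t, ht, htb⟩ := h.exists_tangible_nu_eq hb
  intro e
  refine h.tangible_ne_zero (h.mulTangible s t hs ht) (h.eq_zero_of_nu_eq_zero ?_)
  rw [h.mulMap, hsa, htb, ← h.mulMap, e, h.nu_zero]

theorem nuLE_of_mul_nuLE_mul (h : IsSupertropicalDomain ν) {a b c : R} (ha : a ≠ 0)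
    (hle : NuLE ν (a * b) (a * c)) : NuLE ν b c := by
  by_contra hbc
  have hcb : NuLE ν c b := (h.nuLE_total b c).resolve_left hbc
  have hne : ν b ≠ ν c := fun e => hbc (h.nuLE_of_nu_eq e)
  have heq : ν (a * b) = ν (a * c) := nu_eq_of_nuLE hle (h.nuLE_mul (h.nuLE_refl a) hcb)
  have hb : b ≠ 0 := by
    rintro rfl
    exact hbc (h.zero_nuLE c)
  have hc : c ≠ 0 := by
    rintro rfl
    rw [mul_zero, h.nu_zero] at heq
    exact h.mul_ne_zero ha hb (h.eq_zero_of_nu_eq_zero heq)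
  obtain ⟨r, hr, hra⟩ := h.exists_tangible_nu_eq ha
  obtain ⟨s, hs, hsb⟩ := h.exists_tangible_nu_eq hb
  obtain ⟨t, ht, htc⟩ := h.exists_tangible_nu_eq hc
  have hst : ν (r * s) = ν (r * t) := by
    rw [h.mulMap, h.mulMap, hra, hsb, htc, ← h.mulMap, ← h.mulMap, heq]
  have hsum := h.addEq _ _ hst
  rw [← mul_add] at hsum
  rcases h.addNe s t (by rwa [hsb, htc]) with e | e <;> rw [e] at hsum
  · exact h.mulTangible r s hr hs ⟨_, hsum.symm⟩
  · exact h.mulTangible r t hr ht ⟨_, hsum.symm⟩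

variable {m : Type*} [Fintype m] {A : Matrix m m R}

theorem entry_mul_entry_nuLE (h : IsSupertropicalDomain ν) (hA : A * A = A) (i j k : m) :
    NuLE ν (A i j * A j k) (A i k) := by
  have := h.nuLE_sum_of_mem (fun j => A i j * A j k) (Finset.mem_univ j)
  rwa [← Matrix.mul_apply, hA] at this

variable [DecidableEq m]

/-- In an idempotent matrix, a strictly dominant permutation has weight at least `1`. -/
theorem one_nuLE_of_dominant (h : IsSupertropicalDomain ν) (hA : A * A = A)
    {σ : Equiv.Perm m} (h0 : ∏ i, A i (σ i) ≠ 0)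
    (hσ : ∀ τ : Equiv.Perm m, τ ≠ σ → ¬ NuLE ν (∏ i, A i (σ i)) (∏ i, A i (τ i))) :
    NuLE ν 1 (∏ i, A i (σ i)) := by
  have hmax (τ : Equiv.Perm m) : NuLE ν (∏ i, A i (τ i)) (∏ i, A i (σ i)) := by
    by_cases e : τ = σ
    · rw [e]
      exact h.nuLE_refl _
    · exact (h.nuLE_total _ _).resolve_right (hσ τ e)
  have hk (i : m) : ∃ k, NuLE ν (A i (σ i)) (A i k * A k (σ i)) := by
    have hne : A i (σ i) ≠ 0 := fun e => h0 (Finset.prod_eq_zero (Finset.mem_univ i) e)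
    have hle : NuLE ν (A i (σ i)) (∑ k, A i k * A k (σ i)) := by
      rw [← Matrix.mul_apply, hA]
      exact h.nuLE_refl _
    obtain ⟨k, -, hle⟩ := h.exists_nuLE_of_nuLE_sum hne hle
    exact ⟨k, hle⟩
  choose k hk using hk
  have hprod : NuLE ν (∏ i, A i (σ i)) ((∏ i, A i (k i)) * ∏ i, A (k i) (σ i)) := by
    rw [← Finset.prod_mul_distrib]
    exact h.nuLE_prod _ fun i _ => hk i
  have hinj : Function.Injective k := by
    intro i j hij
    by_contra hne
    refine hσ (σ * Equiv.swap i j) ?_ (nuLE_trans hprod ?_)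
    · intro e
      exact hne (Equiv.swap_eq_one_iff.mp (mul_eq_left.mp e))
    · have hks (x : m) : k (Equiv.swap i j x) = k x := by
        rcases eq_or_ne x i with rfl | hxi
        · rw [Equiv.swap_apply_left, hij]
        rcases eq_or_ne x j with rfl | hxj
        · rw [Equiv.swap_apply_right, hij]
        rw [Equiv.swap_apply_of_ne_of_ne hxi hxj]
      rw [← Equiv.prod_comp (Equiv.swap i j) fun x => A (k x) (σ x), ← Finset.prod_mul_distrib]
      refine h.nuLE_prod _ fun x _ => ?_
      rw [hks]
      exact h.entry_mul_entry_nuLE hA _ _ _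
  let κ : Equiv.Perm m := Equiv.ofBijective k (Finite.injective_iff_bijective.mp hinj)
  have hκ : ∏ i, A (k i) (σ i) = ∏ i, A i ((σ * κ⁻¹) i) := by
    rw [← Equiv.prod_comp κ fun i => A i ((σ * κ⁻¹) i)]
    refine Finset.prod_congr rfl fun i _ => ?_
    exact congrArg (fun x => A (k i) (σ x)) (κ.symm_apply_apply i).symm
  refine h.nuLE_of_mul_nuLE_mul h0 ?_
  rw [mul_one]
  refine nuLE_trans hprod (h.nuLE_mul (hmax κ) ?_)
  rw [hκ]
  exact hmax _

/-- In an idempotent matrix, a strictly dominant permutation is the identity. -/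
theorem eq_one_of_dominant (h : IsSupertropicalDomain ν) (hA : A * A = A)
    {σ : Equiv.Perm m} (h0 : ∏ i, A i (σ i) ≠ 0)
    (hσ : ∀ τ : Equiv.Perm m, τ ≠ σ → ¬ NuLE ν (∏ i, A i (σ i)) (∏ i, A i (τ i))) :
    σ = 1 := by
  by_contra hne
  refine hσ (σ * σ) (fun e => hne (mul_eq_left.mp e)) ?_
  have hsq : NuLE ν ((∏ i, A i (σ i)) * ∏ i, A i (σ i)) (∏ i, A i ((σ * σ) i)) := by
    nth_rewrite 2 [← Equiv.prod_comp σ]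
    rw [← Finset.prod_mul_distrib]
    exact h.nuLE_prod _ fun i _ => h.entry_mul_entry_nuLE hA _ _ _
  refine nuLE_trans ?_ hsq
  have := h.nuLE_mul (h.nuLE_refl (∏ i, A i (σ i))) (h.one_nuLE_of_dominant hA h0 hσ)
  rwa [mul_one] at this

theorem diag_eq_one (h : IsSupertropicalDomain ν) (hA : A * A = A)
    (hns : stPer A ∉ Set.range ν) (i : m) : A i i = 1 := by
  obtain ⟨σ, -, heq, hσ⟩ := h.exists_dominant_of_sum_tangible hns
  have htan : ∏ i, A i (σ i) ∉ Set.range ν := by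
    rw [← heq]
    exact hns
  have hdom := fun τ hτ => hσ τ (Finset.mem_univ τ) hτ
  obtain rfl := h.eq_one_of_dominant hA (h.tangible_ne_zero htan) hdom
  have hge := h.one_nuLE_of_dominant hA (h.tangible_ne_zero htan) hdom
  simp only [Equiv.Perm.one_apply] at htan hdom hge
  have hdiag (j : m) : A j j ∉ Set.range ν := fun hj => by
    rw [← Finset.mul_prod_erase _ _ (Finset.mem_univ j)] at htan
    exact htan (h.ghost_mul_mem_range _ hj)
  have hle (j : m) : NuLE ν (A j j) 1 := by
    refine h.nuLE_of_mul_nuLE_mul (h.tangible_ne_zero (hdiag j)) ?_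
    rw [mul_one]
    exact h.entry_mul_entry_nuLE hA _ _ _
  have hprod_le (s : Finset m) : NuLE ν (∏ j ∈ s, A j j) 1 := by
    simpa using h.nuLE_prod s fun j _ => hle j
  have hone (j : m) : NuLE ν 1 (A j j) := by
    rw [← Finset.mul_prod_erase _ _ (Finset.mem_univ j)] at hge
    have := nuLE_trans hge (h.nuLE_mul (h.nuLE_refl (A j j)) (hprod_le _))
    rwa [mul_one] at this
  have hlt (j : m) (hj : j ≠ i) : ¬ NuLE ν 1 (A i j * A j i) := fun hij => by
    refine hdom (Equiv.swap i j) (fun e => hj (Equiv.swap_eq_one_iff.mp e).symm)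
      (nuLE_trans (hprod_le _) ?_)
    rw [← Finset.mul_prod_erase _ _ (Finset.mem_univ i),
      ← Finset.mul_prod_erase _ _ (Finset.mem_erase.mpr ⟨hj, Finset.mem_univ j⟩),
      Equiv.swap_apply_left, Equiv.swap_apply_right, ← mul_assoc, ← mul_one 1]
    refine h.nuLE_mul hij ?_
    rw [← Finset.prod_const_one (s := (Finset.univ.erase i).erase j)]
    refine h.nuLE_prod _ fun x hx => ?_
    simp only [Finset.mem_erase, Finset.mem_univ, and_true] at hx
    rw [Equiv.swap_apply_of_ne_of_ne hx.2 hx.1]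
    exact hone x
  have hsq : A i i = A i i * A i i := by
    have hsum : A i i = ∑ j, A i j * A j i := by rw [← Matrix.mul_apply, hA]
    rw [← Finset.add_sum_erase _ _ (Finset.mem_univ i), add_comm,
      h.add_eq_right_of_not_nuLE] at hsum
    · exact hsum
    · intro hge'
      obtain ⟨j, hj, hle'⟩ := h.exists_nuLE_of_nuLE_sum
        (h.tangible_ne_zero (h.mulTangible _ _ (hdiag i) (hdiag i))) hge'
      refine hlt j (Finset.ne_of_mem_erase hj) (nuLE_trans ?_ hle')
      simpa using h.nuLE_mul (hone i) (hone i)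
  exact (h.cancelTangible _ _ _ (hdiag i) h.oneTangible (hdiag i) (by rwa [mul_one])).symm

theorem offDiag_mem_range (h : IsSupertropicalDomain ν) (hA : A * A = A)
    (hdiag : ∀ i, A i i = 1) {i j : m} (hij : i ≠ j) : A i j ∈ Set.range ν := by
  by_contra htan
  have hsum : A i j = ∑ k, A i k * A k j := by rw [← Matrix.mul_apply, hA]
  rw [← Finset.add_sum_erase _ _ (Finset.mem_univ i),
    ← Finset.add_sum_erase _ _ (Finset.mem_erase.mpr ⟨hij.symm, Finset.mem_univ j⟩),
    hdiag, hdiag, one_mul, mul_one, ← add_assoc, ← h.ghost] at hsum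
  set r := ∑ k ∈ (Finset.univ.erase i).erase j, A i k * A k j
  by_cases e : ν (ν (A i j)) = ν r
  · exact htan ⟨_, ((h.addEq _ _ e).symm.trans hsum.symm)⟩
  · rcases h.addNe _ _ e with e' | e'
    · exact htan ⟨_, (hsum.trans e').symm⟩
    · exact e (by rw [h.idem, ← hsum.trans e'])

end IsSupertropicalDomain

/-- Proposition 3.3: over a supertropical domain, any multiplicatively
idempotent nonsingular matrix is a quasi-identity matrix. -/
theorem idempotent_nonsingular_is_quasi_identity {R : Type*} [CommSemiring R] (ν : R → R)
    (hST : IsSupertropicalDomain ν) {n : ℕ} (A : Matrix (Fin n) (Fin n) R)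
    (hidem : A * A = A) (hns : stPer A ∉ Set.range ν) :
    (∀ i, A i i = 1) ∧ (∀ i j, i ≠ j → A i j ∈ Set.range ν) := by
  have hdiag := hST.diag_eq_one hidem hns
  exact ⟨hdiag, fun _ _ hij => hST.offDiag_mem_range hidem hdiag hij⟩
end

section
/- Let R be a commutative semiring, let b : {1,…,n} → {1,…,η} be a surjective nondecreasing map, and let A ∈ M_n(R) be block triangular with respect to b (A(i,j) = 0 whenever b(i) > b(j)). Then the permanent of A is the product of the permanents of its diagonal blocks: |A| = |A_1| · |A_2| ··· |A_η|. -/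
/-- The `t`-th diagonal block of `A` with respect to the block structure `b`. -/
def stDiagBlock {n η : ℕ} {R : Type*} [CommSemiring R] (b : Fin n → Fin η)
    (A : Matrix (Fin n) (Fin n) R) (t : Fin η) :
    Matrix {i : Fin n // b i = t} {i : Fin n // b i = t} R :=
  fun i j => A i.1 j.1

/-- A permutation that weakly increases `b` at every point preserves `b`. -/
theorem Equiv.Perm.apply_eq_of_forall_le {ι α : Type*} [Finite ι] [PartialOrder α] {b : ι → α}
    {σ : Equiv.Perm ι} (h : ∀ i, b i ≤ b (σ i)) (i : ι) : b (σ i) = b i := by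
  have hpow (k : ℕ) (j : ι) : b j ≤ b ((σ ^ k) j) := by
    induction k with
    | zero => simp
    | succ k ih =>
      rw [pow_succ', Equiv.Perm.mul_apply]
      exact ih.trans (h _)
  obtain ⟨k, hk, hσ⟩ := (isOfFinOrder_of_finite σ).exists_pow_eq_one
  obtain ⟨m, rfl⟩ := Nat.exists_eq_succ_of_ne_zero hk.ne'
  refine le_antisymm ((hpow m (σ i)).trans_eq ?_) (h i)
  rw [← Equiv.Perm.mul_apply, ← pow_succ, hσ, Equiv.Perm.one_apply]

/-- The permutation acting on each fiber of `b` by a given permutation. -/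
def Equiv.Perm.ofFibers {ι α : Type*} (b : ι → α) (τ : ∀ t, Equiv.Perm {i // b i = t}) :
    Equiv.Perm ι :=
  (Equiv.sigmaFiberEquiv b).permCongr (Equiv.Perm.sigmaCongrRight τ)

theorem Equiv.Perm.ofFibers_apply_coe {ι α : Type*} (b : ι → α)
    (τ : ∀ t, Equiv.Perm {i // b i = t}) {t : α} (i : {i // b i = t}) :
    Equiv.Perm.ofFibers b τ i = τ t i := by
  obtain ⟨i, rfl⟩ := i
  rfl

theorem Equiv.Perm.ofFibers_injective {ι α : Type*} (b : ι → α) :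
    Function.Injective (Equiv.Perm.ofFibers b) := by
  intro τ τ' h
  ext t i
  rw [← ofFibers_apply_coe, ← ofFibers_apply_coe, h]

theorem Equiv.Perm.mem_range_ofFibers {ι α : Type*} {b : ι → α} {σ : Equiv.Perm ι}
    (h : ∀ i, b (σ i) = b i) : σ ∈ Set.range (Equiv.Perm.ofFibers b) :=
  ⟨fun t => σ.subtypePerm fun i => by rw [h i], Equiv.ext fun i =>
    ofFibers_apply_coe b _ (⟨i, rfl⟩ : {j // b j = b i})⟩

/-- Proposition 3.5, determinant part: the permanent of a block triangular
matrix over a commutative semiring is the product of the permanents of its diagonal blocks. -/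
theorem per_block_triangular {R : Type*} [CommSemiring R] {n η : ℕ}
    (b : Fin n → Fin η) (hmono : Monotone b) (hsurj : Function.Surjective b)
    (A : Matrix (Fin n) (Fin n) R) (htri : ∀ i j : Fin n, b j < b i → A i j = 0) :
    stPer A = ∏ t : Fin η, stPer (stDiagBlock b A t) := by
  symm
  simp only [stPer]
  rw [Finset.prod_univ_sum, Fintype.piFinset_univ]
  refine Fintype.sum_of_injective (Equiv.Perm.ofFibers b) (Equiv.Perm.ofFibers_injective b) _ _
    (fun σ hσ => ?_) (fun τ => ?_)
  · have hlt : ∃ i, b (σ i) < b i := by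
      by_contra! h
      exact hσ (Equiv.Perm.mem_range_ofFibers (Equiv.Perm.apply_eq_of_forall_le h))
    obtain ⟨i, hi⟩ := hlt
    exact Finset.prod_eq_zero (Finset.mem_univ i) (htri _ _ hi)
  · rw [← Fintype.prod_fiberwise b]
    simp only [Equiv.Perm.ofFibers_apply_coe, stDiagBlock]
end

section
/- Let R be a supertropical domain, let b : {1,…,n} → {1,…,η} be a surjective nondecreasing map, and let A ∈ M_n(R) be block triangular with respect to b, with diagonal blocks B_1, …, B_η. Then for every m ≥ 1, the characteristic polynomial of A^m equals the product of the characteristic polynomials of the B_t^m: |λI + A^m| = ∏_{t=1}^η |λI + B_t^m| in R[λ]. -/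
/-- The supertropical characteristic polynomial `|λI + A|`: the permanent of `λI + A`
computed in the polynomial semiring `R[λ]`. -/
noncomputable def stCharPoly {m : Type*} [Fintype m] [DecidableEq m] {R : Type*}
    [CommSemiring R] (A : Matrix m m R) : Polynomial R :=
  ∑ σ : Equiv.Perm m, ∏ i, ((if i = σ i then Polynomial.X else 0) + Polynomial.C (A i (σ i)))


theorem Equiv.Perm.ofFibers_apply {ι α : Type*} (b : ι → α)
    (τ : ∀ t, Equiv.Perm {i // b i = t}) (t : α) (i : {i // b i = t}) :
    Equiv.Perm.ofFibers b τ i = τ t i := by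
  obtain ⟨i, rfl⟩ := i
  rfl

/-- The permanent of a block triangular matrix is the product of the permanents of its diagonal
blocks. -/
theorem Matrix.BlockTriangular.stPer_eq_prod {ι α R : Type*} [Fintype ι] [DecidableEq ι]
    [Fintype α] [LinearOrder α] [CommSemiring R] {b : ι → α} {M : Matrix ι ι R}
    (hM : M.BlockTriangular b) : stPer M = ∏ t, stPer (M.toSquareBlock b t) := by
  simp only [stPer]
  rw [Finset.prod_univ_sum, Fintype.piFinset_univ]
  refine (Fintype.sum_of_injective (Equiv.Perm.ofFibers b) (Equiv.Perm.ofFibers_injective b)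
    _ _ (fun σ hσ => ?_) fun τ => ?_).symm
  · by_contra hne
    refine hσ (Equiv.Perm.mem_range_ofFibers (Equiv.Perm.apply_eq_of_forall_le fun i => ?_))
    by_contra hi
    exact hne (Finset.prod_eq_zero (Finset.mem_univ i) (hM (not_le.mp hi)))
  · rw [← Fintype.prod_fiberwise b]
    refine Finset.prod_congr rfl fun t _ => Finset.prod_congr rfl fun i _ => ?_
    rw [Equiv.Perm.ofFibers_apply]
    rfl

theorem stCharPoly_eq_stPer {ι R : Type*} [Fintype ι] [DecidableEq ι] [CommSemiring R]
    (M : Matrix ι ι R) :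
    stCharPoly M = stPer (Matrix.diagonal (fun _ => Polynomial.X) + M.map Polynomial.C) := by
  simp only [stCharPoly, stPer, Matrix.add_apply, Matrix.diagonal_apply, Matrix.map_apply]

/-- The characteristic polynomial of a block triangular matrix is the product of the
characteristic polynomials of its diagonal blocks. -/
theorem Matrix.BlockTriangular.stCharPoly_eq_prod {ι α R : Type*} [Fintype ι] [DecidableEq ι]
    [Fintype α] [LinearOrder α] [CommSemiring R] {b : ι → α} {M : Matrix ι ι R}
    (hM : M.BlockTriangular b) : stCharPoly M = ∏ t, stCharPoly (M.toSquareBlock b t) := by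
  rw [stCharPoly_eq_stPer, ((Matrix.blockTriangular_diagonal _).add
    (hM.map Polynomial.C)).stPer_eq_prod]
  refine Finset.prod_congr rfl fun t _ => ?_
  rw [stCharPoly_eq_stPer]
  congr 1
  ext1 i j
  simp [Matrix.toSquareBlock_def, Matrix.diagonal_apply, Subtype.ext_iff]

theorem Matrix.BlockTriangular.toSquareBlock_mul {ι α R : Type*} [Fintype ι]
    [LinearOrder α] [CommSemiring R] {b : ι → α} {M N : Matrix ι ι R}
    (hM : M.BlockTriangular b) (hN : N.BlockTriangular b) (t : α) :
    (M * N).toSquareBlock b t = M.toSquareBlock b t * N.toSquareBlock b t := by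
  ext i j
  simp only [Matrix.toSquareBlock_def, Matrix.mul_apply, Matrix.of_apply]
  refine (Fintype.sum_of_injective _ Subtype.val_injective _ _ (fun k hk => ?_)
    fun _ => rfl).symm
  have hkt : b k ≠ t := by simpa using hk
  rcases hkt.lt_or_gt with h | h
  · rw [hM (i.2.symm ▸ h : b k < b i), zero_mul]
  · rw [hN (j.2.symm ▸ h : b j < b k), mul_zero]

theorem Matrix.BlockTriangular.toSquareBlock_pow {ι α R : Type*} [Fintype ι] [DecidableEq ι]
    [LinearOrder α] [CommSemiring R] {b : ι → α} {M : Matrix ι ι R}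
    (hM : M.BlockTriangular b) (t : α) (m : ℕ) :
    (M ^ m).toSquareBlock b t = M.toSquareBlock b t ^ m := by
  induction m with
  | zero =>
    ext i j
    simp [Matrix.toSquareBlock_def, Matrix.one_apply, Subtype.ext_iff]
  | succ m ih => rw [pow_succ, pow_succ, (hM.pow m).toSquareBlock_mul hM, ih]

/-- Lemma 3.14: over a supertropical domain, if `A` is block triangular
with diagonal blocks `B_1, …, B_η`, then for every `m ≥ 1` the characteristic polynomial of
`A^m` is the product of the characteristic polynomials of the `B_t^m`. -/
theorem charPoly_pow_block_triangular {R : Type*} [CommSemiring R] (ν : R → R)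
    (hST : IsSupertropicalDomain ν) {n η : ℕ}
    (b : Fin n → Fin η) (hmono : Monotone b) (hsurj : Function.Surjective b)
    (A : Matrix (Fin n) (Fin n) R) (htri : ∀ i j : Fin n, b j < b i → A i j = 0)
    (m : ℕ) (hm : 1 ≤ m) :
    stCharPoly (A ^ m) = ∏ t : Fin η, stCharPoly ((stDiagBlock b A t) ^ m) := by
  have hA : A.BlockTriangular b := fun i j h => htri i j h
  rw [(hA.pow m).stCharPoly_eq_prod]
  refine Finset.prod_congr rfl fun t _ => ?_
  rw [hA.toSquareBlock_pow]
  rfl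
end

section
/- Let R be a supertropical domain and A ∈ M_n(R). Suppose μ ∈ {1,…,n} is the least leading index of A (in particular, a leading index exists). Then μ(A^μ) = 1; that is, 1 is a leading index of A^μ: writing the characteristic polynomial of A^μ as λ^n + Σ_{k=1}^n α'_k λ^{n-k}, one has (α'_1)^k ≥ν α'_k for all k ∈ {1,…,n}. -/
/-- `ℓ` is a leading index of `A` (for `1 ≤ ℓ ≤ n`) if, writing the characteristic
polynomial of `A` as `λ^n + Σ_{k=1}^n α_k λ^{n-k}`, one has `α_ℓ^k ≥ν α_k^ℓ` for all
`1 ≤ k ≤ n`, where `x ≥ν y` means `ν x + ν y = ν x`. -/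
def stLeadingIndex {R : Type*} [CommSemiring R] (ν : R → R) {n : ℕ}
    (A : Matrix (Fin n) (Fin n) R) (ℓ : ℕ) : Prop :=
  1 ≤ ℓ ∧ ℓ ≤ n ∧ ∀ k : ℕ, 1 ≤ k → k ≤ n →
    ν (((stCharPoly A).coeff (n - ℓ)) ^ k) + ν (((stCharPoly A).coeff (n - k)) ^ ℓ) =
      ν (((stCharPoly A).coeff (n - ℓ)) ^ k)

open Finset in
theorem coeff_stCharPoly {m R : Type*} [Fintype m] [DecidableEq m] [CommSemiring R]
    (A : Matrix m m R) (d : ℕ) :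
    (stCharPoly A).coeff d = ∑ σ : Equiv.Perm m, ∑ t : Finset m,
      if d = #t ∧ ∀ i ∈ t, i = σ i then ∏ i ∈ tᶜ, A i (σ i) else 0 := by
  simp only [stCharPoly, Polynomial.finsetSum_coeff, Fintype.prod_add]
  refine sum_congr rfl fun σ _ => sum_congr rfl fun t _ => ?_
  rw [← map_prod, Polynomial.coeff_mul_C]
  by_cases h : ∀ i ∈ t, i = σ i
  · rw [prod_congr rfl fun i hi => if_pos (h i hi), prod_const, Polynomial.coeff_X_pow]
    by_cases hd : d = #t <;> simp [hd]
    intro x hx hx'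
    exact absurd (h x hx) hx'
  · have h' := h
    push Not at h'
    obtain ⟨i, hi, hne⟩ := h'
    rw [prod_eq_zero hi (if_neg hne), Polynomial.coeff_zero, zero_mul, if_neg fun h' => h h'.2]

section MaxPlus

open Finset

variable {R Γ : Type*} [CommSemiring R] [LinearOrderedCommMonoidWithZero Γ] {v : R →*₀ Γ}

theorem map_le_map_sum (hv : ∀ a b, v (a + b) = max (v a) (v b)) {ι : Type*} (s : Finset ι)
    (f : ι → R) {i : ι} (hi : i ∈ s) : v (f i) ≤ v (∑ j ∈ s, f j) := by
  classical
  rw [← add_sum_erase s f hi, hv]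
  exact le_max_left _ _

theorem map_sum_eq_zero_or_exists (hv : ∀ a b, v (a + b) = max (v a) (v b)) {ι : Type*}
    (s : Finset ι) (f : ι → R) :
    v (∑ j ∈ s, f j) = 0 ∨ ∃ i ∈ s, v (∑ j ∈ s, f j) = v (f i) := by
  classical
  induction s using Finset.induction_on with
  | empty => simp
  | insert a s ha ih =>
    rw [sum_insert ha, hv]
    rcases max_choice (v (f a)) (v (∑ j ∈ s, f j)) with h | h <;> rw [h]
    · exact Or.inr ⟨a, mem_insert_self _ _, rfl⟩
    · exact ih.imp_right fun ⟨i, hi, h⟩ => ⟨i, mem_insert_of_mem hi, h⟩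

variable {n : ℕ}

theorem map_prod_le_coeff_of_fixes (hv : ∀ a b, v (a + b) = max (v a) (v b))
    (A : Matrix (Fin n) (Fin n) R) (σ : Equiv.Perm (Fin n)) (c : Finset (Fin n))
    (hσ : ∀ x ∉ c, σ x = x) :
    v (∏ x ∈ c, A x (σ x)) ≤ v ((stCharPoly A).coeff (n - #c)) := by
  rw [coeff_stCharPoly]
  refine le_trans ?_ (map_le_map_sum hv _ _ (mem_univ σ))
  refine le_trans ?_ (map_le_map_sum hv _ _ (mem_univ cᶜ))
  rw [if_pos, compl_compl]
  exact ⟨by simp [card_compl], fun i hi => (hσ i (by simpa using hi)).symm⟩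

theorem map_coeff_eq_zero_or_exists (hv : ∀ a b, v (a + b) = max (v a) (v b))
    (A : Matrix (Fin n) (Fin n) R) {k : ℕ} (hk : k ≤ n) :
    v ((stCharPoly A).coeff (n - k)) = 0 ∨ ∃ (σ : Equiv.Perm (Fin n)) (c : Finset (Fin n)),
      #c = k ∧ (∀ x ∉ c, σ x = x) ∧
      v ((stCharPoly A).coeff (n - k)) = v (∏ x ∈ c, A x (σ x)) := by
  rw [or_iff_not_imp_left]
  intro h0
  rw [coeff_stCharPoly] at h0 ⊢
  obtain ⟨σ, -, hσ⟩ := (map_sum_eq_zero_or_exists hv _ _).resolve_left h0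
  rw [hσ] at h0
  obtain ⟨t, -, ht⟩ := (map_sum_eq_zero_or_exists hv _ _).resolve_left h0
  rw [ht] at h0
  split_ifs at h0 ht with h
  · refine ⟨σ, tᶜ, ?_, ?_, hσ.trans ht⟩
    · rw [card_compl, Fintype.card_fin]
      omega
    · intro x hx
      exact (h.2 x (by simpa using hx)).symm
  · simp at h0

/-- A family of edges forming a bijection between its sources and its targets contributes to the
corresponding coefficient of the characteristic polynomial. -/
theorem map_prod_le_coeff (hv : ∀ a b, v (a + b) = max (v a) (v b))
    (A : Matrix (Fin n) (Fin n) R) {ι : Type*} (I : Finset ι) (src tgt : ι → Fin n)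
    (hsrc : Set.InjOn src I) (himg : I.image tgt = I.image src) :
    v (∏ i ∈ I, A (src i) (tgt i)) ≤ v ((stCharPoly A).coeff (n - #I)) := by
  classical
  rcases I.eq_empty_or_nonempty with rfl | ⟨i₀, -⟩
  · simpa using map_prod_le_coeff_of_fixes hv A 1 ∅ (by simp)
  have : Nonempty ι := ⟨i₀⟩
  have htgt : Set.InjOn tgt I := by
    rw [← card_image_iff, himg, card_image_iff]
    exact hsrc
  set c := I.image src with hc
  let g : Fin n → Fin n := fun x => if x ∈ c then tgt (Function.invFunOn src I x) else x
  have hinv : ∀ i ∈ I, Function.invFunOn src I (src i) = i := fun i hi =>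
    hsrc.leftInvOn_invFunOn hi
  have hg : ∀ i ∈ I, g (src i) = tgt i := fun i hi => by
    simp only [g, hinv i hi, hc, if_pos (mem_image_of_mem src hi)]
  have hg' : ∀ x ∉ c, g x = x := fun x hx => if_neg hx
  have hgc : ∀ x ∈ c, g x ∈ c := by
    intro x hx
    obtain ⟨i, hi, rfl⟩ := mem_image.1 hx
    rw [hg i hi, ← himg]
    exact mem_image_of_mem _ hi
  have hinj : Function.Injective g := by
    intro x y hxy
    by_cases hx : x ∈ c <;> by_cases hy : y ∈ c
    · obtain ⟨i, hi, rfl⟩ := mem_image.1 hx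
      obtain ⟨j, hj, rfl⟩ := mem_image.1 hy
      rw [hg i hi, hg j hj] at hxy
      rw [htgt hi hj hxy]
    · exact absurd (hg' y hy ▸ hxy ▸ hgc x hx) hy
    · exact absurd (hg' x hx ▸ hxy ▸ hgc y hy) hx
    · rwa [hg' x hx, hg' y hy] at hxy
  have key := map_prod_le_coeff_of_fixes hv A
    (Equiv.ofBijective g (Finite.injective_iff_bijective.1 hinj)) c hg'
  rw [card_image_of_injOn hsrc, prod_image hsrc] at key
  refine le_of_eq_of_le (congrArg v (prod_congr rfl fun i hi => ?_)) key
  rw [Equiv.ofBijective_apply, hg i hi]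

/-- If all coefficients of the characteristic polynomial are bounded by powers of `a`, so are the
weights of all closed walks. -/
theorem map_closedWalk_le (hv : ∀ a b, v (a + b) = max (v a) (v b))
    (A : Matrix (Fin n) (Fin n) R) {a : Γ} {μ : ℕ}
    (H : ∀ k, 1 ≤ k → k ≤ n → v ((stCharPoly A).coeff (n - k)) ^ μ ≤ a ^ k)
    (L : ℕ) (p : ℕ → Fin n) (hp : p L = p 0) :
    v (∏ t ∈ range L, A (p t) (p (t + 1))) ^ μ ≤ a ^ L := by
  induction L using Nat.strong_induction_on generalizing p with
  | _ L ih =>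
  by_cases hinj : Set.InjOn p (range L)
  · rcases Nat.eq_zero_or_pos L with rfl | hL
    · simp
    have himg : (range L).image (fun t => p (t + 1)) = (range L).image p := by
      ext x
      simp only [mem_image, mem_range]
      constructor
      · rintro ⟨t, ht, rfl⟩
        rcases Nat.lt_or_ge (t + 1) L with h | h
        · exact ⟨t + 1, h, rfl⟩
        · exact ⟨0, hL, by rw [← hp]; congr 1; omega⟩
      · rintro ⟨t, ht, rfl⟩
        rcases t with _ | t
        · exact ⟨L - 1, by omega, by rw [← hp]; congr 1; omega⟩
        · exact ⟨t, by omega, rfl⟩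
    have hLn : L ≤ n := by
      have := card_le_univ ((range L).image p)
      rwa [card_image_of_injOn hinj, card_range, Fintype.card_fin] at this
    have key := map_prod_le_coeff hv A (range L) p (fun t => p (t + 1)) hinj himg
    rw [card_range] at key
    exact (pow_le_pow_left₀ zero_le key μ).trans (H L hL hLn)
  · obtain ⟨i, j, hij, hjL, hpij⟩ : ∃ i j, i < j ∧ j < L ∧ p i = p j := by
      simp only [Set.InjOn, coe_range, Set.mem_Iio] at hinj
      push Not at hinj
      obtain ⟨i, hi, j, hj, hpij, hne⟩ := hinj
      rcases lt_or_gt_of_ne hne with h | h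
      · exact ⟨i, j, h, hj, hpij⟩
      · exact ⟨j, i, h, hi, hpij.symm⟩
    obtain ⟨d, rfl⟩ := Nat.exists_eq_add_of_lt hij
    obtain ⟨e, rfl⟩ := Nat.exists_eq_add_of_lt hjL
    set d' := d + 1
    set e' := e + 1
    let q : ℕ → Fin n := fun t => if t ≤ i then p t else p (t + d')
    have hq : ∀ s, q (i + s) = p (i + d' + s) := by
      intro s
      rcases s with _ | s
      · exact (if_pos le_rfl).trans hpij
      · simp only [q]
        rw [if_neg (by omega)]
        congr 1
        omega
    have hinner := ih d' (by omega) (fun t => p (i + t)) hpij.symm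
    have houter := ih (i + e') (by omega) q (by
      rw [hq]
      exact hp.trans (if_pos (Nat.zero_le i)).symm)
    have hprod : ∏ t ∈ range (i + e'), A (q t) (q (t + 1)) =
        (∏ t ∈ range i, A (p t) (p (t + 1))) *
          ∏ t ∈ range e', A (p (i + d' + t)) (p (i + d' + t + 1)) := by
      rw [prod_range_add]
      congr 1
      · refine prod_congr rfl fun t ht => ?_
        rw [mem_range] at ht
        simp only [q, if_pos ht.le, if_pos (show t + 1 ≤ i from ht)]
      · exact prod_congr rfl fun t _ => congrArg₂ A (hq t) (hq (t + 1))
    have hL : i + d + 1 + e + 1 = i + d' + e' := rfl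
    rw [hprod] at houter
    rw [hL, prod_range_add, prod_range_add]
    calc _ = v (∏ t ∈ range d', A (p (i + t)) (p (i + (t + 1)))) ^ μ *
          v ((∏ t ∈ range i, A (p t) (p (t + 1))) *
            ∏ t ∈ range e', A (p (i + d' + t)) (p (i + d' + t + 1))) ^ μ := by
          rw [← mul_pow, ← map_mul, mul_left_comm, mul_assoc]
          rfl
      _ ≤ a ^ d' * a ^ (i + e') := mul_le_mul' hinner houter
      _ = a ^ (i + d' + e') := by
          rw [← pow_add]
          congr 1
          omega

theorem map_walk_le_pow_apply (hv : ∀ a b, v (a + b) = max (v a) (v b))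
    (B : Matrix (Fin n) (Fin n) R) (p : ℕ → Fin n) (L : ℕ) :
    v (∏ t ∈ range L, B (p t) (p (t + 1))) ≤ v ((B ^ L) (p 0) (p L)) := by
  induction L with
  | zero => simp
  | succ L ih =>
    rw [prod_range_succ, pow_succ, Matrix.mul_apply, map_mul]
    refine le_trans ?_ (map_le_map_sum hv _ _ (mem_univ (p L)))
    rw [map_mul]
    gcongr

theorem map_pow_apply_eq_zero_or_exists (hv : ∀ a b, v (a + b) = max (v a) (v b))
    (B : Matrix (Fin n) (Fin n) R) (L : ℕ) (i j : Fin n) :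
    v ((B ^ L) i j) = 0 ∨ ∃ p : ℕ → Fin n, p 0 = i ∧ p L = j ∧
      v ((B ^ L) i j) = v (∏ t ∈ range L, B (p t) (p (t + 1))) := by
  induction L generalizing j with
  | zero =>
    by_cases h : i = j
    · exact Or.inr ⟨fun _ => i, rfl, h, by simp [h]⟩
    · simp [h]
  | succ L ih =>
    rw [or_iff_not_imp_left]
    intro h0
    rw [pow_succ, Matrix.mul_apply] at h0 ⊢
    obtain ⟨k, -, hk⟩ := (map_sum_eq_zero_or_exists hv _ _).resolve_left h0
    rw [hk, map_mul] at h0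
    obtain ⟨p, hp0, hpL, hp⟩ := (ih k).resolve_left (left_ne_zero_of_mul h0)
    refine ⟨fun t => if t ≤ L then p t else j, by simpa using hp0, by simp, ?_⟩
    rw [hk, map_mul, hp, prod_range_succ, map_mul]
    congr 2
    · refine prod_congr rfl fun t ht => ?_
      rw [mem_range] at ht
      simp only [if_pos ht.le, if_pos (show t + 1 ≤ L from ht)]
    · simp [hpL]

theorem map_pow_apply_self_le (hv : ∀ a b, v (a + b) = max (v a) (v b))
    (A : Matrix (Fin n) (Fin n) R) {a : Γ} {μ : ℕ} (hμ : μ ≠ 0)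
    (H : ∀ k, 1 ≤ k → k ≤ n → v ((stCharPoly A).coeff (n - k)) ^ μ ≤ a ^ k)
    (L : ℕ) (i : Fin n) : v ((A ^ L) i i) ^ μ ≤ a ^ L := by
  rcases map_pow_apply_eq_zero_or_exists hv A L i i with h | ⟨p, h0, hL, h⟩
  · rw [h, zero_pow hμ]
    exact zero_le
  · rw [h]
    exact map_closedWalk_le hv A H L p (hL.trans h0.symm)

/-- Splitting off from an invariant set of a permutation the orbit of one of its points. -/
theorem exists_orbit_subset {α : Type*} [Finite α] [DecidableEq α] (σ : Equiv.Perm α)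
    {c : Finset α} (hc : c.image σ = c) {i : α} (hi : i ∈ c) :
    ∃ d ⊆ c, i ∈ d ∧ d.image σ = d ∧ (c \ d).image σ = c \ d ∧ σ^[#d] i = i ∧
      ∀ {M : Type*} [CommMonoid M] (B : α → α → M),
        ∏ x ∈ d, B x (σ x) = ∏ t ∈ range #d, B (σ^[t] i) (σ^[t + 1] i) := by
  set l := Function.minimalPeriod σ i
  have hl : 0 < l := Function.minimalPeriod_pos_of_mem_periodicPts (σ.injective.mem_periodicPts i)
  have hinj : Set.InjOn (fun t => σ^[t] i) (range l) := by
    simpa using Function.iterate_injOn_Iio_minimalPeriod (f := σ) (x := i)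
  have hcard : #((range l).image fun t => σ^[t] i) = l := by
    rw [card_image_of_injOn hinj, card_range]
  have hdc : ((range l).image fun t => σ^[t] i) ⊆ c := by
    intro x hx
    obtain ⟨t, -, rfl⟩ := mem_image.1 hx
    clear hx
    induction t with
    | zero => exact hi
    | succ t ih =>
      rw [← hc]
      rw [Function.iterate_succ_apply']
      exact mem_image_of_mem _ ih
  have hd : ((range l).image fun t => σ^[t] i).image σ = (range l).image fun t => σ^[t] i := by
    refine eq_of_subset_of_card_le ?_ (card_image_of_injective _ σ.injective).ge
    intro x hx
    obtain ⟨y, hy, rfl⟩ := mem_image.1 hx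
    obtain ⟨t, ht, rfl⟩ := mem_image.1 hy
    rw [mem_range] at ht
    rw [← Function.iterate_succ_apply' σ, mem_image]
    rcases Nat.lt_or_ge (t + 1) l with h | h
    · exact ⟨t + 1, mem_range.2 h, rfl⟩
    · refine ⟨0, mem_range.2 hl, ?_⟩
      rw [show t.succ = l by omega]
      exact (Function.iterate_minimalPeriod (f := σ) (x := i)).symm
  refine ⟨_, hdc, mem_image.2 ⟨0, mem_range.2 hl, rfl⟩, hd, ?_, ?_, ?_⟩
  · rw [image_sdiff _ _ σ.injective, hc, hd]
  · rw [hcard]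
    exact Function.iterate_minimalPeriod
  · intro M _ B
    rw [hcard, prod_image hinj]
    simp only [Function.iterate_succ_apply']

theorem image_eq_of_fixes {α : Type*} [DecidableEq α] (σ : Equiv.Perm α) {c : Finset α}
    (hσ : ∀ x ∉ c, σ x = x) : c.image σ = c := by
  refine eq_of_subset_of_card_le ?_ (card_image_of_injective _ σ.injective).ge
  intro x hx
  obtain ⟨y, hy, rfl⟩ := mem_image.1 hx
  by_contra hc
  exact hc ((σ.injective (hσ _ hc)).symm ▸ hy)

theorem map_prod_pow_le (hv : ∀ a b, v (a + b) = max (v a) (v b))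
    (A : Matrix (Fin n) (Fin n) R) {a : Γ} {μ : ℕ} (hμ : μ ≠ 0)
    (H : ∀ k, 1 ≤ k → k ≤ n → v ((stCharPoly A).coeff (n - k)) ^ μ ≤ a ^ k)
    (m : ℕ) (σ : Equiv.Perm (Fin n)) (c : Finset (Fin n)) (hc : c.image σ = c) :
    v (∏ x ∈ c, (A ^ m) x (σ x)) ^ μ ≤ a ^ (m * #c) := by
  induction c using Finset.strongInduction with
  | _ c ih =>
  rcases c.eq_empty_or_nonempty with rfl | ⟨i, hi⟩
  · simp
  obtain ⟨d, hdc, hid, -, hcd, hper, hprod⟩ := exists_orbit_subset σ hc hi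
  have h₁ := ih (c \ d) (sdiff_ssubset hdc ⟨i, hid⟩) hcd
  have h₂ : v (∏ x ∈ d, (A ^ m) x (σ x)) ≤ v ((A ^ (m * #d)) i i) := by
    have := map_walk_le_pow_apply hv (A ^ m) (fun t => σ^[t] i) #d
    beta_reduce at this
    rw [hper, ← pow_mul] at this
    exact (congrArg v (hprod (A ^ m))).trans_le this
  have h₃ := (pow_le_pow_left₀ zero_le h₂ μ).trans
    (map_pow_apply_self_le hv A hμ H (m * #d) i)
  rw [← prod_sdiff hdc, map_mul, mul_pow, ← card_sdiff_add_card_eq_card hdc, mul_add, pow_add]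
  exact mul_le_mul' h₁ h₃

/-- The characteristic coefficients of `A ^ m` are bounded by powers of `a` when those of `A`
are. -/
theorem map_coeff_pow_le (hv : ∀ a b, v (a + b) = max (v a) (v b))
    (A : Matrix (Fin n) (Fin n) R) {a : Γ} {μ : ℕ} (hμ : μ ≠ 0)
    (H : ∀ k, 1 ≤ k → k ≤ n → v ((stCharPoly A).coeff (n - k)) ^ μ ≤ a ^ k)
    (m : ℕ) {k : ℕ} (hk : k ≤ n) :
    v ((stCharPoly (A ^ m)).coeff (n - k)) ^ μ ≤ a ^ (m * k) := by
  rcases map_coeff_eq_zero_or_exists hv (A ^ m) hk with h | ⟨σ, c, rfl, hσ, h⟩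
  · rw [h, zero_pow hμ]
    exact zero_le
  · rw [h]
    exact map_prod_pow_le hv A hμ H m σ c (image_eq_of_fixes σ hσ)

/-- If `μ` is the least index with `α_μ ^ k ≥ α_k ^ μ` for all `k`, then `α_μ` is attained by a
single cycle, whence a diagonal entry of `A ^ μ` dominates `α_μ`. -/
theorem map_coeff_le_map_coeff_pow (hv : ∀ a b, v (a + b) = max (v a) (v b))
    (A : Matrix (Fin n) (Fin n) R) {μ : ℕ} (hμ : 1 ≤ μ) (hμn : μ ≤ n)
    (H : ∀ k, 1 ≤ k → k ≤ n →
      v ((stCharPoly A).coeff (n - k)) ^ μ ≤ v ((stCharPoly A).coeff (n - μ)) ^ k)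
    (hleast : ∀ l, 1 ≤ l → l ≤ n → (∀ k, 1 ≤ k → k ≤ n →
      v ((stCharPoly A).coeff (n - k)) ^ l ≤ v ((stCharPoly A).coeff (n - l)) ^ k) → μ ≤ l) :
    v ((stCharPoly A).coeff (n - μ)) ≤ v ((stCharPoly (A ^ μ)).coeff (n - 1)) := by
  have hμ0 : μ ≠ 0 := by omega
  rcases map_coeff_eq_zero_or_exists hv A hμn with h | ⟨σ, c, hcμ, hσ, h⟩
  · rw [h]
    exact zero_le
  by_cases ha : v ((stCharPoly A).coeff (n - μ)) = 0
  · rw [ha]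
    exact zero_le
  obtain ⟨i, hi⟩ : c.Nonempty := card_pos.1 (by omega)
  have hc := image_eq_of_fixes σ hσ
  obtain ⟨d, hdc, hid, hd, hcd, hper, hprod⟩ := exists_orbit_subset σ hc hi
  have hdpos : 1 ≤ #d := card_pos.2 ⟨i, hid⟩
  have hdμ : #d ≤ μ := hcμ ▸ card_le_card hdc
  set a := v ((stCharPoly A).coeff (n - μ)) with ha_def
  have hrest : v (∏ x ∈ c \ d, A x (σ x)) ^ μ ≤ a ^ #(c \ d) := by
    simpa using map_prod_pow_le hv A hμ0 H 1 σ (c \ d) hcd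
  have hcycle : v (∏ x ∈ d, A x (σ x)) ≤ v ((stCharPoly A).coeff (n - #d)) :=
    map_prod_le_coeff hv A d id σ Function.injective_id.injOn (by rw [hd, image_id])
  have hsplit : a ^ μ = v (∏ x ∈ c \ d, A x (σ x)) ^ μ * v (∏ x ∈ d, A x (σ x)) ^ μ := by
    rw [h, ← mul_pow, ← map_mul, prod_sdiff hdc]
  have hcoeff : a ^ #d ≤ v ((stCharPoly A).coeff (n - #d)) ^ μ := by
    refine le_trans ?_ (pow_le_pow_left₀ zero_le hcycle μ)
    have hpos : 0 < a ^ #(c \ d) := pow_pos (zero_lt_iff.2 ha) _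
    refine le_of_mul_le_mul_left ?_ hpos
    rw [← pow_add, card_sdiff_add_card_eq_card hdc, hcμ, hsplit]
    gcongr
  have hμd : μ ≤ #d := hleast #d hdpos (hdμ.trans hμn) fun k hk hkn => by
    rw [← pow_le_pow_iff_left₀ zero_le zero_le hμ0]
    calc (v ((stCharPoly A).coeff (n - k)) ^ #d) ^ μ
        = (v ((stCharPoly A).coeff (n - k)) ^ μ) ^ #d := pow_right_comm _ _ _
      _ ≤ (a ^ k) ^ #d := pow_le_pow_left₀ zero_le (H k hk hkn) _
      _ = (a ^ #d) ^ k := pow_right_comm _ _ _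
      _ ≤ (v ((stCharPoly A).coeff (n - #d)) ^ μ) ^ k := by gcongr
      _ = _ := pow_right_comm _ _ _
  obtain rfl : d = c := eq_of_subset_of_card_le hdc (by omega)
  have hwalk := map_walk_le_pow_apply hv A (fun t => σ^[t] i) #d
  beta_reduce at hwalk
  rw [hper, ← hprod A, hcμ, ← h] at hwalk
  refine hwalk.trans ?_
  simpa using map_prod_le_coeff hv (A ^ μ) {i} id id Function.injective_id.injOn rfl

end MaxPlus

universe u in
/-- The `ν`-classes of a supertropical domain form a linearly ordered commutative monoid with
zero, on which addition is the maximum. -/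
theorem IsSupertropicalDomain.exists_max_valuation {R : Type u} [CommSemiring R] {ν : R → R}
    (h : IsSupertropicalDomain ν) :
    ∃ (Γ : Type u) (_ : LinearOrderedCommMonoidWithZero Γ) (v : R →*₀ Γ),
      (∀ a b, v (a + b) = max (v a) (v b)) ∧ ∀ a b, ν a + ν b = ν a ↔ v b ≤ v a := by
  classical
  let r : RingCon R :=
    { r := fun a b => ν a = ν b
      iseqv := ⟨fun _ => rfl, Eq.symm, Eq.trans⟩
      mul' := fun {w x y z} h₁ h₂ => by rw [h.mulMap, h.mulMap, h₁, h₂]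
      add' := fun {w x y z} h₁ h₂ => by rw [h.addMap, h.addMap, h₁, h₂] }
  have hr : ∀ a b : R, (a : r.Quotient) = b ↔ ν a = ν b := fun a b => r.eq
  have hν0 : ν 0 = 0 := by rw [h.ghost, add_zero]
  have hidem : ∀ x : r.Quotient, x + x = x := by
    intro x
    induction x using Quotient.inductionOn' with | _ a
    exact (hr (a + a) a).2 (by rw [← h.ghost, h.idem])
  have htotal : ∀ x y : r.Quotient, x + y = x ∨ x + y = y := by
    intro x y
    induction x using Quotient.inductionOn' with | _ a
    induction y using Quotient.inductionOn' with | _ b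
    by_cases hab : ν a = ν b
    · exact Or.inl ((hr (a + b) a).2 (by rw [h.addEq a b hab, h.idem]))
    · exact (h.addNe a b hab).imp (fun e => (hr (a + b) a).2 (by rw [e]))
        fun e => (hr (a + b) b).2 (by rw [e])
  have htan : ∀ x : r.Quotient, x ≠ 0 → ∃ t : R, t ∉ Set.range ν ∧ (t : r.Quotient) = x := by
    intro x hx
    induction x using Quotient.inductionOn' with | _ a
    obtain ⟨t, ht, hta⟩ := h.onto (ν a) ⟨a, rfl⟩ fun h0 => hx ((hr a 0).2 (h0.trans hν0.symm))
    exact ⟨t, ht, (hr t a).2 hta⟩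
  have hcancel : ∀ x y z : r.Quotient, x ≠ 0 → x * y = x * z → y = z := by
    intro x y z hx hxyz
    by_contra hyz
    obtain ⟨t, ht, rfl⟩ := htan x hx
    have hzero : ∀ w : r.Quotient, (t : r.Quotient) * w = 0 → w = 0 := by
      intro w hw
      by_contra hw0
      obtain ⟨s, hs, rfl⟩ := htan w hw0
      have hts : ν (t * s) = ν 0 := (hr (t * s) 0).1 hw
      refine h.mulTangible t s ht hs ⟨t * s, ?_⟩
      rw [← h.addEq _ _ hts, add_zero]
    by_cases hy : y = 0
    · rw [hy, mul_zero] at hxyz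
      exact hyz (hy.trans (hzero z hxyz.symm).symm)
    by_cases hz : z = 0
    · rw [hz, mul_zero] at hxyz
      exact hyz ((hzero y hxyz).trans hz.symm)
    obtain ⟨b, hb, rfl⟩ := htan y hy
    obtain ⟨c, hc, rfl⟩ := htan z hz
    have hghost : t * (b + c) = ν (t * b) := by
      rw [mul_add]
      exact h.addEq _ _ ((hr (t * b) (t * c)).1 hxyz)
    rcases h.addNe b c fun e => hyz ((hr b c).2 e) with e | e <;> rw [e] at hghost
    · exact h.mulTangible t b ht hb ⟨_, hghost.symm⟩
    · exact h.mulTangible t c ht hc ⟨_, hghost.symm⟩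
  let ord : LinearOrder r.Quotient :=
    { le := fun x y => x + y = y
      le_refl := hidem
      le_trans := fun x y z (hxy : x + y = y) (hyz : y + z = z) => by
        rw [← hyz, ← add_assoc, hxy]
      le_antisymm := fun x y (hxy : x + y = y) (hyx : y + x = x) => by
        rw [← hxy, add_comm, hyx]
      le_total := fun x y => (htotal x y).symm.imp_right fun e => (add_comm y x).trans e
      toDecidableLE := Classical.decRel _ }
  have hle : ∀ x y : r.Quotient, x ≤ y ↔ x + y = y := fun _ _ => Iff.rfl
  let inst : LinearOrderedCommMonoidWithZero r.Quotient :=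
    { (inferInstance : CommMonoidWithZero r.Quotient), ord with
      mul_lt_mul_of_pos_left := fun x hx y z hyz => by
        refine lt_of_le_of_ne ?_ fun e => hyz.ne (hcancel x y z hx.ne' e)
        rw [hle, ← mul_add, (hle y z).1 hyz.le]
      bot := 0
      bot_le := fun x => zero_add x
      isBot_zero := fun x => zero_add x }
  refine ⟨r.Quotient, inst, (r.mk' : R →+* r.Quotient).toMonoidWithZeroHom, fun a b => ?_, fun a b => ?_⟩
  · change (a : r.Quotient) + b = max (a : r.Quotient) b
    rcases le_total (a : r.Quotient) b with hab | hab
    · rw [max_eq_right hab]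
      exact hab
    · rw [max_eq_left hab, add_comm]
      exact hab
  · rw [← h.addMap, add_comm, ← hr]
    rfl

/-- Lemma 4.14: over a supertropical domain, if `μ` is the least leading
index of `A`, then `μ(A^μ) = 1`, i.e. `1` is a leading index of `A^μ`. -/
theorem mu_pow_mu_eq_one {R : Type*} [CommSemiring R] (ν : R → R)
    (hST : IsSupertropicalDomain ν) {n : ℕ} (A : Matrix (Fin n) (Fin n) R)
    (μ : ℕ) (hlead : stLeadingIndex ν A μ)
    (hleast : ∀ ℓ : ℕ, stLeadingIndex ν A ℓ → μ ≤ ℓ) :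
    stLeadingIndex ν (A ^ μ) 1 := by
  obtain ⟨Γ, _, v, hv, hle⟩ := hST.exists_max_valuation
  simp only [stLeadingIndex, hle, map_pow] at hlead hleast ⊢
  obtain ⟨h1, hn, H⟩ := hlead
  have hμ : μ ≠ 0 := by omega
  refine ⟨le_rfl, h1.trans hn, fun k _ hk => ?_⟩
  have hlow := map_coeff_le_map_coeff_pow hv A h1 hn H fun l hl hln hl' => hleast l ⟨hl, hln, hl'⟩
  have hup := map_coeff_pow_le hv A hμ H μ hk
  rw [mul_comm, pow_mul, pow_le_pow_iff_left₀ zero_le zero_le hμ] at hup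
  rw [pow_one]
  exact hup.trans (pow_le_pow_left₀ zero_le hlow k)
end

section
/- Let R be a supertropical domain, A ∈ M_n(R), and β ∈ T ∪ {0}. Let V_β = { v ∈ R^n : there exists m ≥ 1 such that A^m v ghost-surpasses β^m v }. Then V_β is an A-invariant subspace: (i) if v, w ∈ V_β then v + w ∈ V_β; (ii) if v ∈ V_β and c ∈ R then c·v ∈ V_β; (iii) if v ∈ V_β then Av ∈ V_β. -/
/-- Ghost-surpassing amounts to adding a vector of the form `u + u`. -/
lemma IsSupertropical.ghostSurpasses_iff {R ι : Type*} [CommSemiring R] {ν : R → R}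
    (h : IsSupertropical ν) (x y : ι → R) :
    (∃ g : ι → R, (∀ i, g i ∈ Set.range ν) ∧ x = y + g) ↔ ∃ u : ι → R, x = y + (u + u) := by
  constructor
  · rintro ⟨g, hg, rfl⟩
    choose u hu using hg
    exact ⟨u, by ext i; simp [← hu, h.ghost]⟩
  · rintro ⟨u, rfl⟩
    exact ⟨u + u, fun i => ⟨u i, h.ghost (u i)⟩, rfl⟩

/-- The relation `A ^ m v = β ^ m v + (u + u)` passes to multiples of `m`. -/
lemma exists_pow_mul_mulVec_eq {R ι : Type*} [CommSemiring R] [Fintype ι] [DecidableEq ι]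
    {A : Matrix ι ι R} {β : R} {m : ℕ} {v : ι → R}
    (h : ∃ u : ι → R, (A ^ m).mulVec v = β ^ m • v + (u + u)) (k : ℕ) :
    ∃ u : ι → R, (A ^ (m * k)).mulVec v = β ^ (m * k) • v + (u + u) := by
  obtain ⟨u, hu⟩ := h
  induction k with
  | zero => exact ⟨0, by simp⟩
  | succ k ih =>
    obtain ⟨w, hw⟩ := ih
    refine ⟨β ^ (m * k) • u + (A ^ m).mulVec w, ?_⟩
    rw [Nat.mul_succ, add_comm, pow_add, ← Matrix.mulVec_mulVec, hw, Matrix.mulVec_add,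
      Matrix.mulVec_add, Matrix.mulVec_smul, hu, pow_add, mul_smul, smul_comm (β ^ m),
      smul_add, smul_add]
    abel

/-- Proposition 6.6: over a supertropical domain, the set of generalized
supertropical eigenvectors of `A` for a (tangible or zero) `β`, i.e.
`V_β = {v : ∃ m ≥ 1, A^m v ghost-surpasses β^m v}`, is an `A`-invariant subspace. -/
theorem generalized_eigenspace_invariant_subspace {R : Type*} [CommSemiring R] (ν : R → R)
    (hST : IsSupertropicalDomain ν) {n : ℕ} (A : Matrix (Fin n) (Fin n) R)
    (β : R) (hβ : β ∉ Set.range ν ∨ β = 0) :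
    (∀ v w : Fin n → R,
        (∃ m : ℕ, 1 ≤ m ∧ ∃ g : Fin n → R, (∀ i, g i ∈ Set.range ν) ∧
          (A ^ m).mulVec v = β ^ m • v + g) →
        (∃ m : ℕ, 1 ≤ m ∧ ∃ g : Fin n → R, (∀ i, g i ∈ Set.range ν) ∧
          (A ^ m).mulVec w = β ^ m • w + g) →
        ∃ m : ℕ, 1 ≤ m ∧ ∃ g : Fin n → R, (∀ i, g i ∈ Set.range ν) ∧
          (A ^ m).mulVec (v + w) = β ^ m • (v + w) + g) ∧
    (∀ (v : Fin n → R) (c : R),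
        (∃ m : ℕ, 1 ≤ m ∧ ∃ g : Fin n → R, (∀ i, g i ∈ Set.range ν) ∧
          (A ^ m).mulVec v = β ^ m • v + g) →
        ∃ m : ℕ, 1 ≤ m ∧ ∃ g : Fin n → R, (∀ i, g i ∈ Set.range ν) ∧
          (A ^ m).mulVec (c • v) = β ^ m • (c • v) + g) ∧
    (∀ v : Fin n → R,
        (∃ m : ℕ, 1 ≤ m ∧ ∃ g : Fin n → R, (∀ i, g i ∈ Set.range ν) ∧
          (A ^ m).mulVec v = β ^ m • v + g) →
        ∃ m : ℕ, 1 ≤ m ∧ ∃ g : Fin n → R, (∀ i, g i ∈ Set.range ν) ∧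
          (A ^ m).mulVec (A.mulVec v) = β ^ m • (A.mulVec v) + g) := by
  simp only [hST.toIsSupertropical.ghostSurpasses_iff]
  refine ⟨?_, ?_, ?_⟩
  · rintro v w ⟨m, hm, hv⟩ ⟨k, hk, hw⟩
    obtain ⟨a, ha⟩ := exists_pow_mul_mulVec_eq hv k
    obtain ⟨b, hb⟩ := exists_pow_mul_mulVec_eq hw m
    rw [mul_comm k m] at hb
    refine ⟨m * k, Nat.mul_pos hm hk, a + b, ?_⟩
    rw [Matrix.mulVec_add, ha, hb, smul_add]
    abel
  · rintro v c ⟨m, hm, u, hu⟩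
    refine ⟨m, hm, c • u, ?_⟩
    rw [Matrix.mulVec_smul, hu, smul_add, smul_add, smul_comm]
  · rintro v ⟨m, hm, u, hu⟩
    refine ⟨m, hm, A.mulVec u, ?_⟩
    rw [Matrix.mulVec_mulVec, ← pow_succ, pow_succ', ← Matrix.mulVec_mulVec, hu,
      Matrix.mulVec_add, Matrix.mulVec_add, Matrix.mulVec_smul]
end

section
/- Let R be a supertropical semifield and let A ∈ M_n(R) be nonsingular and in stable block triangular form with respect to a surjective nondecreasing map b : {1,…,n} → {1,…,η}, with tangible semi-idempotent coefficients β_1, …, β_η of its diagonal blocks. Then there exist n tropically independent vectors v_1, …, v_n ∈ R^n such that each v_i is a supertropical eigenvector of A for one of the β_t: for each i there is t ∈ {1,…,η} with A v_i ghost-surpassing β_t v_i. -/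
/-- A supertropical semifield: a supertropical semiring in which the tangible elements
`T = R \ ν(R)` form a multiplicative group and `ν` maps `T` onto `ν(R) \ {0}`. -/
structure IsSupertropicalSemifield {R : Type*} [CommSemiring R] (ν : R → R)
    extends IsSupertropical ν : Prop where
  oneTangible : (1 : R) ∉ Set.range ν
  mulTangible : ∀ a b : R, a ∉ Set.range ν → b ∉ Set.range ν → a * b ∉ Set.range ν
  invTangible : ∀ a : R, a ∉ Set.range ν → ∃ b : R, a * b = 1
  onto : ∀ g ∈ Set.range ν, g ≠ 0 → ∃ t ∉ Set.range ν, ν t = g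


/-- `A` is irreducible if for every pair of vertices `i, j` there is a directed path of
positive length from `i` to `j` in the digraph of `A` (edges where the entry is nonzero). -/
def stIrreducible {m : Type*} {R : Type*} [Zero R] (A : Matrix m m R) : Prop :=
  ∀ i j : m, Relation.TransGen (fun s t => A s t ≠ 0) i j

namespace IsSupertropicalSemifield

variable {R : Type*} [CommSemiring R] {ν : R → R}

theorem zero_mem (h : IsSupertropicalSemifield ν) : (0 : R) ∈ Set.range ν :=
  ⟨0, by rw [h.ghost, add_zero]⟩

theorem nu_zero (h : IsSupertropicalSemifield ν) : ν 0 = 0 := by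
  rw [h.ghost, add_zero]

theorem nu_mem_self (h : IsSupertropicalSemifield ν) {a : R} (ha : a ∈ Set.range ν) :
    ν a = a := by
  obtain ⟨x, rfl⟩ := ha
  exact h.idem x

theorem nu_mul_nu (h : IsSupertropicalSemifield ν) (a b : R) : ν a * b = ν (a * b) := by
  rw [h.ghost, h.ghost, add_mul]

theorem mul_mem (h : IsSupertropicalSemifield ν) (a : R) {b : R} (hb : b ∈ Set.range ν) :
    a * b ∈ Set.range ν := by
  obtain ⟨x, rfl⟩ := hb
  exact ⟨x * a, by rw [← h.nu_mul_nu, mul_comm]⟩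

theorem add_mem (h : IsSupertropicalSemifield ν) {a b : R} (ha : a ∈ Set.range ν)
    (hb : b ∈ Set.range ν) : a + b ∈ Set.range ν :=
  ⟨a + b, by rw [h.addMap, h.nu_mem_self ha, h.nu_mem_self hb]⟩

theorem sum_mem (h : IsSupertropicalSemifield ν) {ι : Type*} (s : Finset ι) (f : ι → R)
    (hf : ∀ i ∈ s, f i ∈ Set.range ν) : ∑ i ∈ s, f i ∈ Set.range ν :=
  Finset.sum_induction f (· ∈ Set.range ν) (fun _ _ => h.add_mem) h.zero_mem hf

theorem eq_zero_of_nu_eq_zero (h : IsSupertropicalSemifield ν) {a : R} (ha : ν a = 0) :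
    a = 0 := by
  have := h.addEq a 0 (by rw [ha, h.nu_zero])
  rwa [add_zero, ha] at this

theorem tangible_ne_zero (h : IsSupertropicalSemifield ν) {a : R} (ha : a ∉ Set.range ν) :
    a ≠ 0 := by
  rintro rfl
  exact ha h.zero_mem

theorem tangible_prod (h : IsSupertropicalSemifield ν) {ι : Type*} (s : Finset ι) (f : ι → R)
    (hf : ∀ i ∈ s, f i ∉ Set.range ν) : ∏ i ∈ s, f i ∉ Set.range ν :=
  Finset.prod_induction f (· ∉ Set.range ν) h.mulTangible h.oneTangible hf

theorem exists_nu_inverse (h : IsSupertropicalSemifield ν) {a : R} (ha : a ≠ 0) :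
    ∃ d, ν (d * a) = ν 1 := by
  obtain ⟨t, ht, hta⟩ := h.onto (ν a) ⟨a, rfl⟩ fun h0 => ha (h.eq_zero_of_nu_eq_zero h0)
  obtain ⟨d, hd⟩ := h.invTangible t ht
  exact ⟨d, by rw [h.mulMap, ← hta, ← h.mulMap, mul_comm, hd]⟩

theorem nuLE_of_nu_eq (h : IsSupertropicalSemifield ν) {a b : R} (hab : ν a = ν b) :
    NuLE ν a b := by
  rw [NuLE, hab, ← h.ghost, h.idem]

theorem nuLE_refl (h : IsSupertropicalSemifield ν) (a : R) : NuLE ν a a :=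
  h.nuLE_of_nu_eq rfl

theorem nuLE_trans {a b c : R} (hab : NuLE ν a b) (hbc : NuLE ν b c) : NuLE ν a c := by
  unfold NuLE at *
  rw [← hbc, ← add_assoc, hab]

theorem nuLE_antisymm {a b : R} (hab : NuLE ν a b) (hba : NuLE ν b a) : ν a = ν b := by
  unfold NuLE at *
  rw [← hab, add_comm, hba]

theorem nuLE_total (h : IsSupertropicalSemifield ν) (a b : R) : NuLE ν a b ∨ NuLE ν b a := by
  by_cases hab : ν a = ν b
  · exact Or.inl (h.nuLE_of_nu_eq hab)
  · rcases h.addNe a b hab with hs | hs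
    · right
      rw [NuLE, add_comm, ← h.addMap, hs]
    · left
      rw [NuLE, ← h.addMap, hs]

theorem nuLE_add_right (h : IsSupertropicalSemifield ν) (a b : R) : NuLE ν a (a + b) := by
  rw [NuLE, h.addMap, ← add_assoc, ← h.ghost, h.idem]

theorem nuLE_mul_left (h : IsSupertropicalSemifield ν) (c : R) {a b : R} (hab : NuLE ν a b) :
    NuLE ν (c * a) (c * b) := by
  unfold NuLE at *
  rw [h.mulMap, h.mulMap, ← mul_add, hab]

theorem nuLE_mul (h : IsSupertropicalSemifield ν) {a b c d : R} (hab : NuLE ν a b)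
    (hcd : NuLE ν c d) : NuLE ν (a * c) (b * d) := by
  refine nuLE_trans (h.nuLE_mul_left a hcd) ?_
  rw [mul_comm a, mul_comm b]
  exact h.nuLE_mul_left d hab

theorem nuLE_of_mul_left (h : IsSupertropicalSemifield ν) {c a b : R} (hc : c ≠ 0)
    (hab : NuLE ν (c * a) (c * b)) : NuLE ν a b := by
  obtain ⟨d, hd⟩ := h.exists_nu_inverse hc
  have key : ∀ x, ν (d * (c * x)) = ν x := fun x => by
    rw [← mul_assoc, h.mulMap, hd, ← h.mulMap, one_mul]
  have := h.nuLE_mul_left d hab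
  rwa [NuLE, key, key] at this

theorem nuLE_prod (h : IsSupertropicalSemifield ν) {ι : Type*} (s : Finset ι) (f g : ι → R)
    (hfg : ∀ i ∈ s, NuLE ν (f i) (g i)) : NuLE ν (∏ i ∈ s, f i) (∏ i ∈ s, g i) := by
  classical
  induction s using Finset.induction_on with
  | empty => exact h.nuLE_refl 1
  | insert i s hi ih =>
    rw [Finset.prod_insert hi, Finset.prod_insert hi]
    exact h.nuLE_mul (hfg i (Finset.mem_insert_self i s))
      (ih fun j hj => hfg j (Finset.mem_insert_of_mem hj))

theorem nuLE_sum (h : IsSupertropicalSemifield ν) {ι : Type*} (s : Finset ι) (f : ι → R)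
    {i : ι} (hi : i ∈ s) : NuLE ν (f i) (∑ j ∈ s, f j) := by
  classical
  rw [← Finset.add_sum_erase s f hi]
  exact h.nuLE_add_right _ _

theorem eq_zero_of_nuLE_zero (h : IsSupertropicalSemifield ν) {a : R} (ha : NuLE ν a 0) :
    a = 0 := by
  rw [NuLE, h.nu_zero, add_zero] at ha
  exact h.eq_zero_of_nu_eq_zero ha

theorem add_eq_right_of_not_nuLE (h : IsSupertropicalSemifield ν) {a b : R}
    (hab : ¬ NuLE ν b a) : a + b = b := by
  rcases h.addNe a b fun e => hab (h.nuLE_of_nu_eq e.symm) with hs | hs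
  · refine absurd ?_ hab
    rw [NuLE, add_comm, ← h.addMap, hs]
  · exact hs

theorem add_eq_right_of_mem (h : IsSupertropicalSemifield ν) {a b : R} (hab : NuLE ν a b)
    (hb : b ∈ Set.range ν) : a + b = b := by
  by_cases hba : NuLE ν b a
  · have e := nuLE_antisymm hab hba
    rw [h.addEq a b e, e, h.nu_mem_self hb]
  · exact h.add_eq_right_of_not_nuLE hba

theorem add_mem_of_nuLE_of_nuLE (h : IsSupertropicalSemifield ν) {a b : R} (hab : NuLE ν a b)
    (hba : NuLE ν b a) : a + b ∈ Set.range ν :=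
  ⟨a, (h.addEq a b (nuLE_antisymm hab hba)).symm⟩

theorem exists_sum_nuLE (h : IsSupertropicalSemifield ν) {ι : Type*} {s : Finset ι}
    (hs : s.Nonempty) (f : ι → R) : ∃ i ∈ s, NuLE ν (∑ j ∈ s, f j) (f i) := by
  classical
  induction hs using Finset.Nonempty.cons_induction with
  | singleton a => exact ⟨a, by simp, by simpa using h.nuLE_refl _⟩
  | cons a s ha hs ih =>
    obtain ⟨i, hi, hle⟩ := ih
    rw [Finset.sum_cons]
    by_cases hc : f a + ∑ j ∈ s, f j = f a
    · exact ⟨a, by simp, by rw [hc]; exact h.nuLE_refl _⟩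
    · refine ⟨i, by simp [hi], nuLE_trans ?_ hle⟩
      rw [NuLE, h.addMap, add_assoc, ← h.ghost, h.idem]
      rcases h.nuLE_total (f a) (∑ j ∈ s, f j) with hl | hl
      · exact hl
      · by_contra hn
        exact hc (by rw [add_comm]; exact h.add_eq_right_of_not_nuLE hn)

/-- A strictly dominant term is equal to the sum. -/
theorem sum_eq_of_strict_max (h : IsSupertropicalSemifield ν) {ι : Type*} (s : Finset ι)
    (f : ι → R) {i : ι} (hi : i ∈ s) (hlt : ∀ j ∈ s, j ≠ i → ¬ NuLE ν (f i) (f j)) :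
    ∑ j ∈ s, f j = f i := by
  classical
  rw [← Finset.add_sum_erase s f hi]
  rcases (s.erase i).eq_empty_or_nonempty with he | hne
  · rw [he, Finset.sum_empty, add_zero]
  · obtain ⟨k, hk, hle⟩ := h.exists_sum_nuLE hne f
    rw [add_comm]
    refine h.add_eq_right_of_not_nuLE fun hn => ?_
    rw [Finset.mem_erase] at hk
    exact hlt k hk.2 hk.1 (nuLE_trans hn hle)

/-- A term of a tangible sum which dominates the sum dominates strictly every other term
and is equal to the sum. -/
theorem strict_max_of_tangible_sum (h : IsSupertropicalSemifield ν) {ι : Type*} (s : Finset ι)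
    (f : ι → R) (hs : ∑ j ∈ s, f j ∉ Set.range ν) {i : ι} (hi : i ∈ s)
    (hmax : NuLE ν (∑ j ∈ s, f j) (f i)) :
    ∑ j ∈ s, f j = f i ∧ ∀ j ∈ s, j ≠ i → ¬ NuLE ν (f i) (f j) := by
  classical
  have hlt : ∀ j ∈ s, j ≠ i → ¬ NuLE ν (f i) (f j) := by
    intro j hj hji hle
    refine hs ?_
    have hj' : j ∈ s.erase i := by simp [hj, hji]
    have hle' : NuLE ν (f i) (∑ k ∈ s.erase i, f k) := nuLE_trans hle (h.nuLE_sum _ f hj')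
    rw [← Finset.add_sum_erase s f hi] at hmax ⊢
    refine h.add_mem_of_nuLE_of_nuLE hle' (nuLE_trans ?_ hmax)
    rw [add_comm]
    exact h.nuLE_add_right _ _
  exact ⟨h.sum_eq_of_strict_max s f hi hlt, hlt⟩

section Idempotent

variable {m : Type*} [Fintype m] {B : Matrix m m R}

theorem idempotent_trans (h : IsSupertropicalSemifield ν) (hB : B * B = B) (i k j : m) :
    NuLE ν (B i k * B k j) (B i j) := by
  conv_rhs => rw [← hB, Matrix.mul_apply]
  exact h.nuLE_sum Finset.univ (fun k => B i k * B k j) (Finset.mem_univ k)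

/-- The diagonal of a nonsingular idempotent matrix is tangible, of ghost value one. -/
theorem diag_of_idempotent (h : IsSupertropicalSemifield ν) [DecidableEq m] (hB : B * B = B)
    (hns : stPer B ∉ Set.range ν) (i : m) : B i i ∉ Set.range ν ∧ ν (B i i) = ν 1 := by
  set P : Equiv.Perm m → R := fun σ => ∏ i, B i (σ i)
  obtain ⟨σ, -, hσ⟩ := h.exists_sum_nuLE Finset.univ_nonempty P
  obtain ⟨heq, huniq⟩ := h.strict_max_of_tangible_sum _ P hns (Finset.mem_univ σ) hσ
  have hmax : ∀ τ, NuLE ν (P τ) (P σ) := fun τ =>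
    nuLE_trans (h.nuLE_sum _ P (Finset.mem_univ τ)) hσ
  have huniq' : ∀ τ, NuLE ν (P σ) (P τ) → τ = σ := fun τ hτ => by
    by_contra hne
    exact huniq τ (Finset.mem_univ τ) hne hτ
  have htan : P σ ∉ Set.range ν := by
    rw [← heq]
    exact hns
  have hP0 : P σ ≠ 0 := h.tangible_ne_zero htan
  have hmid : ∀ i, ∃ k, NuLE ν (B i (σ i)) (B i k * B k (σ i)) := by
    intro i
    obtain ⟨k, -, hk⟩ := h.exists_sum_nuLE (s := Finset.univ) ⟨i, Finset.mem_univ i⟩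
      fun k => B i k * B k (σ i)
    refine ⟨k, ?_⟩
    rwa [← Matrix.mul_apply, hB] at hk
  choose τ hτ using hmid
  have hPτ : NuLE ν (P σ) ((∏ i, B i (τ i)) * ∏ i, B (τ i) (σ i)) := by
    rw [← Finset.prod_mul_distrib]
    exact h.nuLE_prod _ _ _ fun i _ => hτ i
  have hinj : Function.Injective τ := by
    intro i i' hii
    by_contra hne
    have hsw : ∀ l, τ (Equiv.swap i i' l) = τ l := by
      intro l
      rcases eq_or_ne l i with rfl | h1
      · rw [Equiv.swap_apply_left, hii]
      rcases eq_or_ne l i' with rfl | h2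
      · rw [Equiv.swap_apply_right, hii]
      rw [Equiv.swap_apply_of_ne_of_ne h1 h2]
    have hle : NuLE ν (P σ) (P (σ * Equiv.swap i i')) := by
      refine nuLE_trans hPτ ?_
      rw [← Equiv.prod_comp (Equiv.swap i i') fun l => B (τ l) (σ l),
        ← Finset.prod_mul_distrib]
      refine h.nuLE_prod _ _ _ fun l _ => ?_
      rw [hsw]
      exact h.idempotent_trans hB _ _ _
    have hs := huniq' _ hle
    rw [mul_eq_left, Equiv.swap_eq_one_iff] at hs
    exact hne hs
  let ρ : Equiv.Perm m := Equiv.ofBijective τ (Finite.injective_iff_bijective.mp hinj)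
  have hPP : NuLE ν (P σ) (P σ * P σ) := by
    refine nuLE_trans hPτ (h.nuLE_mul (hmax ρ) ?_)
    have : ∏ i, B (τ i) (σ i) = P (σ * ρ⁻¹) := by
      change _ = ∏ i, B i ((σ * ρ⁻¹) i)
      rw [← Equiv.prod_comp ρ fun i => B i ((σ * ρ⁻¹) i)]
      refine Finset.prod_congr rfl fun i _ => ?_
      change B (τ i) (σ i) = B (τ i) (σ (ρ.symm (ρ i)))
      rw [Equiv.symm_apply_apply]
    rw [this]
    exact hmax _
  have hone : NuLE ν 1 (P σ) := by
    refine h.nuLE_of_mul_left hP0 ?_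
    rwa [mul_one]
  have hσ1 : σ = 1 := by
    have hsq : NuLE ν (P σ) (P (σ * σ)) := by
      refine nuLE_trans hPP ?_
      have : P σ = ∏ i, B (σ i) (σ (σ i)) := (Equiv.prod_comp σ fun i => B i (σ i)).symm
      nth_rewrite 2 [this]
      rw [← Finset.prod_mul_distrib]
      exact h.nuLE_prod _ _ _ fun i _ => h.idempotent_trans hB _ _ _
    simpa using huniq' _ hsq
  subst hσ1
  have hdt : ∀ j, B j j ∉ Set.range ν := by
    intro j hj
    refine htan ?_
    change ∏ i, B i i ∈ _
    rw [← Finset.prod_erase_mul _ _ (Finset.mem_univ j)]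
    exact h.mul_mem _ hj
  have hle1 : ∀ j, NuLE ν (B j j) 1 := fun j => by
    refine h.nuLE_of_mul_left (h.tangible_ne_zero (hdt j)) ?_
    rw [mul_one]
    exact h.idempotent_trans hB j j j
  refine ⟨hdt i, nuLE_antisymm (hle1 i) (nuLE_trans hone ?_)⟩
  change NuLE ν (∏ i, B i i) _
  rw [← Finset.mul_prod_erase _ _ (Finset.mem_univ i)]
  have := h.nuLE_mul (h.nuLE_refl (B i i))
    (h.nuLE_prod (Finset.univ.erase i) (fun j => B j j) (fun _ => 1) fun j _ => hle1 j)
  rwa [Finset.prod_const_one, mul_one] at this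

theorem two_cycle_of_idempotent (h : IsSupertropicalSemifield ν) (hB : B * B = B)
    (hd : ∀ i, B i i ∉ Set.range ν ∧ ν (B i i) = ν 1) {i j : m} (hij : i ≠ j) :
    ¬ NuLE ν 1 (B i j * B j i) := by
  have hsum : ∑ k, B i k * B k i = B i i := by rw [← Matrix.mul_apply, hB]
  have hdd : ν (B i i * B i i) = ν 1 := by
    rw [h.mulMap, (hd i).2, ← h.mulMap, one_mul]
  have hmax : NuLE ν (∑ k, B i k * B k i) (B i i * B i i) := by
    rw [hsum]
    exact h.nuLE_of_nu_eq ((hd i).2.trans hdd.symm)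
  intro hle
  exact (h.strict_max_of_tangible_sum Finset.univ (fun k => B i k * B k i)
    (by rw [hsum]; exact (hd i).1) (Finset.mem_univ i) hmax).2 j (Finset.mem_univ j) hij.symm
    (nuLE_trans (h.nuLE_of_nu_eq hdd) hle)

/-- The columns of an idempotent matrix with tangible unit diagonal are tropically
independent. -/
theorem independent_of_idempotent (h : IsSupertropicalSemifield ν) (hB : B * B = B)
    (hd : ∀ i, B i i ∉ Set.range ν ∧ ν (B i i) = ν 1) (α : m → R)
    (hα : ∀ i, α i = 0 ∨ α i ∉ Set.range ν) (hsum : ∀ i, ∑ j, α j * B i j ∈ Set.range ν) :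
    α = 0 := by
  classical
  by_contra hne
  have hdiag : ∀ i, NuLE ν (α i) (α i * B i i) := fun i => by
    refine h.nuLE_of_nu_eq ?_
    rw [h.mulMap, (hd i).2, ← h.mulMap, mul_one]
  have hstep : ∀ i, α i ≠ 0 → ∃ j, j ≠ i ∧ α j ≠ 0 ∧ NuLE ν (α i) (α j * B i j) := by
    intro i hi
    by_contra! hcon
    have ht : α i * B i i ∉ Set.range ν :=
      h.mulTangible _ _ ((hα i).resolve_left hi) (hd i).1
    refine ht ?_
    rw [← h.sum_eq_of_strict_max Finset.univ (fun j => α j * B i j) (Finset.mem_univ i)]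
    · exact hsum i
    · intro j _ hji hle
      have hle' := nuLE_trans (hdiag i) hle
      by_cases hj : α j = 0
      · rw [hj, zero_mul] at hle'
        exact hi (h.eq_zero_of_nuLE_zero hle')
      · exact hcon j hji hj hle'
  let r : m → m → Prop := fun j i => j ≠ i ∧ α i ≠ 0 ∧ α j ≠ 0 ∧ NuLE ν (α i) (α j * B i j)
  have hcomp : ∀ {i j k}, NuLE ν (α i) (α j * B i j) → NuLE ν (α j) (α k * B j k) →
      NuLE ν (α i) (α k * (B i j * B j k)) := by
    intro i j k hij hjk
    refine nuLE_trans hij ?_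
    have := h.nuLE_mul hjk (h.nuLE_refl (B i j))
    rwa [mul_assoc, mul_comm (B j k)] at this
  have : IsTrans m r := ⟨by
    rintro k j i ⟨hkj, hj0, hk0, hjk⟩ ⟨hji, hi0, -, hij⟩
    refine ⟨?_, hi0, hk0, nuLE_trans (hcomp hij hjk)
      (h.nuLE_mul_left _ (h.idempotent_trans hB _ _ _))⟩
    rintro rfl
    refine h.two_cycle_of_idempotent hB hd hkj (h.nuLE_of_mul_left hk0 ?_)
    rw [mul_one]
    exact hcomp hij hjk⟩
  have : Std.Irrefl r := ⟨fun i hi => hi.1 rfl⟩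
  have hwf : WellFounded r := Finite.wellFounded_of_trans_of_irrefl r
  obtain ⟨i, hi⟩ := Function.ne_iff.mp hne
  obtain ⟨k, hk, hmin⟩ := hwf.has_min {i | α i ≠ 0} ⟨i, hi⟩
  obtain ⟨j, hjk, hj, hle⟩ := hstep k hk
  exact hmin j hj ⟨hjk, hk, hj, hle⟩

end Idempotent

section Block

variable {n η : ℕ} {b : Fin n → Fin η} {A : Matrix (Fin n) (Fin n) R} {β : Fin η → R}

theorem sum_diagBlock
    (hsi : ∀ t, stDiagBlock b A t * stDiagBlock b A t = β t • stDiagBlock b A t)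
    {i j : Fin n} (hij : b i = b j) :
    ∑ k, (if b k = b i then A i k * A k j else 0) = β (b i) * A i j := by
  have := congrFun (congrFun (hsi (b i)) ⟨i, rfl⟩) ⟨j, hij.symm⟩
  rw [Matrix.mul_apply] at this
  rw [← Finset.sum_filter, Finset.sum_subtype (p := fun k => b k = b i) _ (by simp)]
  exact this

theorem prod_eq_zero_of_not_preserving (htri : ∀ i j : Fin n, b j < b i → A i j = 0)
    (σ : Equiv.Perm (Fin n)) {i : Fin n} (hi : b i ≠ b (σ i)) : ∏ i, A i (σ i) = 0 := by
  by_contra hne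
  have hle : ∀ k, (b k : ℕ) ≤ b (σ k) := by
    intro k
    by_contra hlt
    exact hne (Finset.prod_eq_zero (Finset.mem_univ k) (htri k _ (not_le.mp hlt)))
  have hs : ∑ k, (b k : ℕ) = ∑ k, (b (σ k) : ℕ) := (Equiv.sum_comp σ fun k => (b k : ℕ)).symm
  have := (Finset.sum_eq_sum_iff_of_le fun k _ => hle k).mp hs i (Finset.mem_univ i)
  exact hi (Fin.ext this)

/-- The normalised block diagonal part of a block triangular matrix. -/
def normDiag (b : Fin n → Fin η) (A : Matrix (Fin n) (Fin n) R) (γ : Fin η → R) :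
    Matrix (Fin n) (Fin n) R :=
  fun i j => if b i = b j then γ (b i) * A i j else 0

variable {γ : Fin η → R}

theorem normDiag_idempotent
    (hsi : ∀ t, stDiagBlock b A t * stDiagBlock b A t = β t • stDiagBlock b A t)
    (hγ : ∀ t, β t * γ t = 1) : normDiag b A γ * normDiag b A γ = normDiag b A γ := by
  ext i j
  rw [Matrix.mul_apply]
  unfold normDiag
  by_cases hij : b i = b j
  · rw [if_pos hij]
    calc _ = ∑ k, γ (b i) * γ (b i) * (if b k = b i then A i k * A k j else 0) := by
          refine Finset.sum_congr rfl fun k _ => ?_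
          by_cases hk : b k = b i
          · rw [if_pos hk.symm, if_pos (hk.trans hij), if_pos hk, hk]
            ring
          · rw [if_neg (Ne.symm hk), if_neg hk, zero_mul, mul_zero]
      _ = (β (b i) * γ (b i)) * (γ (b i) * A i j) := by
          rw [← Finset.mul_sum, sum_diagBlock hsi hij]
          ring
      _ = _ := by rw [hγ, one_mul]
  · rw [if_neg hij]
    refine Finset.sum_eq_zero fun k _ => ?_
    by_cases hk : b i = b k
    · rw [if_neg fun e => hij (hk.trans e), mul_zero]
    · rw [if_neg hk, zero_mul]

theorem stPer_normDiag (htri : ∀ i j : Fin n, b j < b i → A i j = 0) :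
    stPer (normDiag b A γ) = (∏ i, γ (b i)) * stPer A := by
  unfold stPer
  rw [Finset.mul_sum]
  refine Finset.sum_congr rfl fun σ _ => ?_
  by_cases hσ : ∀ i, b i = b (σ i)
  · rw [← Finset.prod_mul_distrib]
    exact Finset.prod_congr rfl fun i _ => if_pos (hσ i)
  · push Not at hσ
    obtain ⟨i, hi⟩ := hσ
    rw [prod_eq_zero_of_not_preserving htri σ hi, mul_zero]
    exact Finset.prod_eq_zero (Finset.mem_univ i) (if_neg hi)

/-- Extension of a partial eigenvector to one further diagonal block. -/
theorem exists_block_extension (h : IsSupertropicalSemifield ν)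
    (hsi : ∀ t, stDiagBlock b A t * stDiagBlock b A t = β t • stDiagBlock b A t)
    (hγ : ∀ t, β t * γ t = 1) (hdiag : ∀ i, ν (A i i) = ν (β (b i))) (s t : Fin η)
    (e : Fin n → R) :
    ∃ y : Fin n → R, (∀ i, b i ≠ s → y i = 0) ∧
      ∀ i, b i = s → ∃ w ∈ Set.range ν, e i + ∑ k, A i k * y k = β t * y i + w := by
  by_cases hst : NuLE ν (β t) (β s)
  · refine ⟨fun i => if b i = s then γ s * ν (e i) else 0, fun i hi => if_neg hi,
      fun i hi => ?_⟩
    set y : Fin n → R := fun i => if b i = s then γ s * ν (e i) else 0 with hy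
    have hmem : ∑ k, A i k * y k ∈ Set.range ν := by
      refine h.sum_mem _ _ fun k _ => h.mul_mem _ ?_
      rw [hy]
      dsimp only
      split_ifs
      · exact h.mul_mem _ ⟨_, rfl⟩
      · exact h.zero_mem
    have hii : NuLE ν (A i i * y i) (∑ k, A i k * y k) :=
      h.nuLE_sum Finset.univ (fun k => A i k * y k) (Finset.mem_univ i)
    have hβy : NuLE ν (β s * y i) (∑ k, A i k * y k) := by
      refine nuLE_trans (h.nuLE_of_nu_eq ?_) hii
      rw [h.mulMap, h.mulMap, hdiag, hi]
    have he : NuLE ν (e i) (β s * y i) := by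
      refine h.nuLE_of_nu_eq ?_
      rw [hy]
      dsimp only
      rw [if_pos hi, ← mul_assoc, hγ, one_mul, h.idem]
    refine ⟨_, hmem, ?_⟩
    rw [h.add_eq_right_of_mem (nuLE_trans he hβy) hmem, h.add_eq_right_of_mem _ hmem]
    exact nuLE_trans (h.nuLE_mul hst (h.nuLE_refl _)) hβy
  · set g : Fin n → R := fun i => ∑ k, (if b k = s then A i k * e k else 0) with hg
    have hgg : ∀ i, b i = s → ∑ k, (if b k = s then A i k * g k else 0) = β s * g i := by
      intro i hi
      calc _ = ∑ k, ∑ l, (if b l = s then (if b k = s then A i k * A k l else 0) * e l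
              else 0) := by
            refine Finset.sum_congr rfl fun k _ => ?_
            by_cases hk : b k = s
            · simp only [if_pos hk, hg, Finset.mul_sum, mul_ite, mul_zero, mul_assoc]
            · simp [hk]
        _ = ∑ l, β s * (if b l = s then A i l * e l else 0) := by
            rw [Finset.sum_comm]
            refine Finset.sum_congr rfl fun l _ => ?_
            by_cases hl : b l = s
            · have := sum_diagBlock hsi (hi.trans hl.symm)
              rw [hi] at this
              simp only [if_pos hl, ← Finset.sum_mul, this, mul_assoc]
            · simp [hl]
        _ = _ := by rw [← Finset.mul_sum]
    have habs : ∀ x : R, β t * x + β s * x = β t * x := by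
      intro x
      rw [← add_mul, add_comm, h.add_eq_right_of_not_nuLE hst]
    refine ⟨fun i => if b i = s then γ t * (e i + γ t * g i) else 0, fun i hi => if_neg hi,
      fun i hi => ⟨0, h.zero_mem, ?_⟩⟩
    have hsum : ∑ k, A i k * (if b k = s then γ t * (e k + γ t * g k) else 0)
        = γ t * g i := by
      calc _ = ∑ k, (γ t * (if b k = s then A i k * e k else 0) +
              γ t * γ t * (if b k = s then A i k * g k else 0)) := by
            refine Finset.sum_congr rfl fun k _ => ?_
            by_cases hk : b k = s
            · simp only [if_pos hk]
              ring
            · simp [hk]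
        _ = γ t * g i + γ t * γ t * (β s * g i) := by
            rw [Finset.sum_add_distrib, ← Finset.mul_sum, ← Finset.mul_sum, hgg i hi]
        _ = γ t * γ t * (β t * g i + β s * g i) := by
            have : γ t * g i = γ t * γ t * (β t * g i) := by
              calc _ = (β t * γ t) * (γ t * g i) := by rw [hγ, one_mul]
                _ = _ := by ring
            rw [mul_add, ← this]
        _ = (β t * γ t) * (γ t * g i) := by
            rw [habs]
            ring
        _ = γ t * g i := by rw [hγ, one_mul]
    beta_reduce
    rw [hsum, if_pos hi, add_zero, ← mul_assoc, hγ, one_mul]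

/-- Each column of a diagonal block extends to a supertropical eigenvector of the whole
matrix. -/
theorem exists_eigenvector (h : IsSupertropicalSemifield ν)
    (htri : ∀ i j : Fin n, b j < b i → A i j = 0)
    (hsi : ∀ t, stDiagBlock b A t * stDiagBlock b A t = β t • stDiagBlock b A t)
    (hγ : ∀ t, β t * γ t = 1) (hdiag : ∀ i, ν (A i i) = ν (β (b i))) (j : Fin n) :
    ∃ v : Fin n → R, (∀ i, b i = b j → v i = A i j) ∧ (∀ i, b j < b i → v i = 0) ∧
      ∀ i, ∃ w ∈ Set.range ν, ∑ k, A i k * v k = β (b j) * v i + w := by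
  suffices H : ∀ d : ℕ, ∃ v : Fin n → R, (∀ i, b i = b j → v i = A i j) ∧
      (∀ i, b j < b i → v i = 0) ∧ ∀ i, (b j : ℕ) ≤ b i + d →
        ∃ w ∈ Set.range ν, ∑ k, A i k * v k = β (b j) * v i + w by
    obtain ⟨v, h1, h2, h3⟩ := H (b j)
    exact ⟨v, h1, h2, fun i => h3 i (Nat.le_add_left _ _)⟩
  intro d
  induction d with
  | zero =>
    refine ⟨fun i => if b i = b j then A i j else 0, fun i hi => if_pos hi,
      fun i hi => if_neg hi.ne', fun i hi => ⟨0, h.zero_mem, ?_⟩⟩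
    beta_reduce
    rw [add_zero]
    rcases (show b j ≤ b i from hi).eq_or_lt with he | hlt
    · rw [if_pos he.symm, he, ← sum_diagBlock hsi he.symm]
      exact Finset.sum_congr rfl fun k _ => by rw [mul_ite, mul_zero]
    · rw [if_neg hlt.ne', mul_zero]
      refine Finset.sum_eq_zero fun k _ => ?_
      split_ifs with hk
      · rw [htri i k (by rwa [hk]), zero_mul]
      · rw [mul_zero]
  | succ d ih =>
    obtain ⟨v, h1, h2, h3⟩ := ih
    by_cases hd : (b j : ℕ) ≤ d
    · exact ⟨v, h1, h2, fun i _ => h3 i (hd.trans (Nat.le_add_left _ _))⟩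
    have hjη := (b j).isLt
    let s : Fin η := ⟨b j - (d + 1), by omega⟩
    have hsval : (s : ℕ) + (d + 1) = b j := by
      change (b j : ℕ) - (d + 1) + (d + 1) = b j
      omega
    set u : Fin n → R := fun i => if s < b i then v i else 0 with hu
    obtain ⟨y, hy0, hy⟩ := h.exists_block_extension hsi hγ hdiag s (b j)
      fun i => ∑ k, A i k * u k
    have hup : ∀ i, s < b i → u i + y i = v i := fun i hi => by
      rw [hy0 i hi.ne', add_zero, hu]
      exact if_pos hi
    have hsj : s < b j := by
      rw [Fin.lt_def]
      omega
    refine ⟨fun i => u i + y i, fun i hi => ?_, fun i hi => ?_, fun i hi => ?_⟩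
    · exact (hup i (hi ▸ hsj)).trans (h1 i hi)
    · exact (hup i (hsj.trans hi)).trans (h2 i hi)
    · by_cases hlt : s < b i
      · obtain ⟨w, hw, he⟩ := h3 i (by rw [Fin.lt_def] at hlt; omega)
        refine ⟨w, hw, ?_⟩
        beta_reduce
        rw [hup i hlt, ← he]
        refine Finset.sum_congr rfl fun k _ => ?_
        by_cases hk : b k < b i
        · rw [htri i k hk, zero_mul, zero_mul]
        · rw [hup k (hlt.trans_le (not_lt.mp hk))]
      · have his : b i = s := by
          rw [Fin.lt_def] at hlt
          ext
          omega
        obtain ⟨w, hw, he⟩ := hy i his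
        refine ⟨w, hw, ?_⟩
        have hui : u i = 0 := if_neg hlt
        beta_reduce
        rw [hui, zero_add, ← he, ← Finset.sum_add_distrib]
        exact Finset.sum_congr rfl fun k _ => mul_add _ _ _

end Block

end IsSupertropicalSemifield

/-- Theorem 6.7: let `A` be nonsingular and in stable block triangular form
with respect to `b`, with tangible semi-idempotent coefficients `β_1, …, β_η` of its
diagonal blocks.  Then there exist `n` tropically independent vectors, each of which is a
supertropical eigenvector of `A` for one of the `β_t`. -/
theorem eigenspace_decomposition {R : Type*} [CommSemiring R] (ν : R → R)
    (hST : IsSupertropicalSemifield ν) {n η : ℕ}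
    (b : Fin n → Fin η) (hmono : Monotone b) (hsurj : Function.Surjective b)
    (A : Matrix (Fin n) (Fin n) R)
    (htri : ∀ i j : Fin n, b j < b i → A i j = 0)
    (hfull : ∀ t : Fin η, stIrreducible (stDiagBlock b A t) ∨
      Fintype.card {i : Fin n // b i = t} = 1)
    (β : Fin η → R) (hβ : ∀ t, β t ∉ Set.range ν)
    (hsi : ∀ t, stDiagBlock b A t * stDiagBlock b A t = β t • stDiagBlock b A t)
    (hstable : ∀ s t : Fin η, s ≤ t → ∃ c : R,
      (∃ u : Fin η, s ≤ u ∧ u ≤ t ∧ (c = β u ∨ c = ν (β u))) ∧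
      ∀ i j : Fin n, b i = s → b j = t → (A * A) i j = c * A i j)
    (hns : stPer A ∉ Set.range ν) :
    ∃ v : Fin n → (Fin n → R),
      (¬ ∃ α : Fin n → R, (∀ i, α i = 0 ∨ α i ∉ Set.range ν) ∧ α ≠ 0 ∧
        ∀ j, (∑ i, α i * v i j) ∈ Set.range ν) ∧
      ∀ i : Fin n, ∃ t : Fin η, ∃ w : Fin n → R, (∀ j, w j ∈ Set.range ν) ∧
        A.mulVec (v i) = β t • v i + w := by
  choose γ hγ using fun t => hST.invTangible (β t) (hβ t)
  have hγt : ∀ t, γ t ∉ Set.range ν := by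
    intro t ht
    refine hST.oneTangible ?_
    rw [← hγ t]
    exact hST.mul_mem _ ht
  set B := IsSupertropicalSemifield.normDiag b A γ with hBdef
  have hB : B * B = B := IsSupertropicalSemifield.normDiag_idempotent hsi hγ
  have hBns : stPer B ∉ Set.range ν := by
    rw [hBdef, IsSupertropicalSemifield.stPer_normDiag htri]
    exact hST.mulTangible _ _ (hST.tangible_prod _ _ fun i _ => hγt _) hns
  have hd := hST.diag_of_idempotent hB hBns
  have hdiag : ∀ i, ν (A i i) = ν (β (b i)) := by
    intro i
    have hBi : B i i = γ (b i) * A i i := if_pos rfl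
    have hAi : A i i = β (b i) * B i i := by rw [hBi, ← mul_assoc, hγ, one_mul]
    rw [hAi, hST.mulMap, (hd i).2, ← hST.mulMap, mul_one]
  choose v hv1 hv2 hv3 using hST.exists_eigenvector htri hsi hγ hdiag
  refine ⟨v, ?_, fun i => ?_⟩
  · classical
    rintro ⟨α, hα, hα0, hsum⟩
    obtain ⟨i₀, hi₀⟩ := Function.ne_iff.mp hα0
    obtain ⟨i, hi, hmax⟩ := Finset.exists_max_image (Finset.univ.filter fun i => α i ≠ 0) b
      ⟨i₀, by simpa using hi₀⟩
    have hmax' : ∀ j, b i < b j → α j = 0 := fun j hj => by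
      by_contra hne
      exact absurd (hmax j (by simpa using hne)) (not_le.mpr hj)
    have hzero := hST.independent_of_idempotent hB hd (fun j => if b j = b i then α j else 0)
      (fun j => by
        split_ifs
        · exact hα j
        · exact Or.inl rfl)
      (fun l => by
        by_cases hl : b l = b i
        · have hle : ∑ j, (if b j = b i then α j else 0) * B l j
              = γ (b i) * ∑ j, α j * v j l := by
            rw [Finset.mul_sum]
            refine Finset.sum_congr rfl fun j _ => ?_
            rcases lt_trichotomy (b j) (b i) with hj | hj | hj
            · rw [if_neg hj.ne, hv2 j l (hl ▸ hj), zero_mul, mul_zero, mul_zero]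
            · have hBl : B l j = γ (b l) * A l j := if_pos (hl.trans hj.symm)
              rw [if_pos hj, hv1 j l (hl.trans hj.symm), hBl, hl]
              ring
            · rw [if_neg hj.ne', hmax' j hj, zero_mul, zero_mul, mul_zero]
          rw [hle]
          exact hST.mul_mem _ (hsum l)
        · rw [Finset.sum_eq_zero]
          · exact hST.zero_mem
          · intro j _
            by_cases hj : b j = b i
            · have hBl : B l j = 0 := if_neg fun e => hl (e.trans hj)
              rw [hBl, mul_zero]
            · rw [if_neg hj, zero_mul])
    have := congrFun hzero i
    rw [if_pos rfl] at this
    exact (Finset.mem_filter.mp hi).2 this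
  · choose w hw he using hv3 i
    exact ⟨b i, w, hw, funext he⟩
end
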